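/- arXiv:0910.0676 — 3 statements merged into one kernel-verified Lean document; each statement's English description precedes it below -/
import Mathlib

section
/- Let K be a complete discrete valuation field with algebraically closed residue field of characteristic p > 0, and let L/K be a finite Galois extension with Galois group G ≅ P ⋊ ℤ/m, where P is the p-Sylow subgroup of G and p ∤ m. If P is abelian, then every upper jump of the ramification filtration of L/K (in particular, the conductor of higher ramification of L/K) lies in (1/m)ℤ. -/
open Multiplicative

/-- The `i`-th ramification group of `L/K` in the lower numbering, defined with respect to the
normalized discrete valuation `vL` on `L` (with values in `ℤₘ₀ = WithZero (Multiplicative ℤ)`,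
a uniformizer having value `ofAdd (-1)`), assumed invariant under the Galois action:
`G_i = {σ ∈ Gal(L/K) | v_L(σ x - x) ≥ i + 1 for all x ∈ O_L}`. -/
def ramificationGroup {K L : Type*} [Field K] [Field L] [Algebra K L]
    (vL : Valuation L (WithZero (Multiplicative ℤ)))
    (hGal : ∀ (σ : L ≃ₐ[K] L) (x : L), vL (σ x) = vL x) (i : ℕ) :
    Subgroup (L ≃ₐ[K] L) where
  carrier := {σ | ∀ x : L, vL x ≤ 1 →
    vL (σ x - x) ≤ ((ofAdd (-(i + 1) : ℤ) : Multiplicative ℤ) : WithZero (Multiplicative ℤ))}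
  one_mem' := by
    intro x _
    simp
  mul_mem' := by
    intro σ τ hσ hτ x hx
    have hτx : vL (τ x) ≤ 1 := by rw [hGal]; exact hx
    have h1 : (σ * τ) x - x = (σ (τ x) - σ x) + (σ x - x) := by
      rw [AlgEquiv.mul_apply]; ring
    rw [h1]
    refine le_trans (Valuation.map_add _ _ _) (max_le ?_ ?_)
    · have h2 : σ (τ x) - σ x = σ (τ x - x) := by rw [map_sub]
      rw [h2, hGal]
      exact hτ x hx
    · exact hσ x hx
  inv_mem' := by
    intro σ hσ x hx
    have h1 : σ (σ⁻¹ x - x) = x - σ x := by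
      rw [map_sub]
      congr 1
      rw [← AlgEquiv.mul_apply, mul_inv_cancel, AlgEquiv.one_apply]
    have h2 : vL (σ⁻¹ x - x) = vL (x - σ x) := by rw [← hGal σ, h1]
    rw [h2, ← Valuation.map_neg, neg_sub]
    exact hσ x hx

/-- The Herbrand function `φ_{L/K}` evaluated at the integer `u`:
`φ(u) = (|G_1| + ⋯ + |G_u|)/|G_0|`, so that the upper-numbering jump corresponding to a
lower-numbering jump `j` is `φ(j)` (and the jumps in the upper numbering are exactly the
values `φ(j)` at jumps `j` of the lower numbering). -/
noncomputable def herbrandPhi {K L : Type*} [Field K] [Field L] [Algebra K L]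
    (vL : Valuation L (WithZero (Multiplicative ℤ)))
    (hGal : ∀ (σ : L ≃ₐ[K] L) (x : L), vL (σ x) = vL x) (u : ℕ) : ℚ :=
  (∑ r ∈ Finset.range u, (Nat.card ↥(ramificationGroup vL hGal (r + 1)) : ℚ)) /
    (Nat.card ↥(ramificationGroup vL hGal 0) : ℚ)

/-- A `ℤ`-valued order function on the nonzero elements of a field. -/
structure OrdFunction (F : Type*) [Field F] where
  /-- the underlying function, whose value at `0` is irrelevant -/
  ord : F → ℤ
  ord_mul' : ∀ {x y : F}, x ≠ 0 → y ≠ 0 → ord (x * y) = ord x + ord y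
  min_le_ord_add' : ∀ {x y : F}, x ≠ 0 → y ≠ 0 → x + y ≠ 0 → min (ord x) (ord y) ≤ ord (x + y)

namespace OrdFunction

open Polynomial

variable {F : Type*} [Field F] (w : OrdFunction F)

/-- `w.Ge r x` says that the order of `x` is at least `r`, the order of `0` being infinite. -/
def Ge (r : ℤ) (x : F) : Prop := x = 0 ∨ r ≤ w.ord x

lemma ord_mul {x y : F} (hx : x ≠ 0) (hy : y ≠ 0) : w.ord (x * y) = w.ord x + w.ord y :=
  w.ord_mul' hx hy

lemma ord_one : w.ord 1 = 0 := by
  have := w.ord_mul (one_ne_zero (α := F)) one_ne_zero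
  rw [mul_one] at this
  omega

lemma ord_neg (x : F) : w.ord (-x) = w.ord x := by
  have h1 := w.ord_mul (neg_ne_zero.2 (one_ne_zero (α := F))) (neg_ne_zero.2 one_ne_zero)
  rw [neg_mul_neg, one_mul, w.ord_one] at h1
  rcases eq_or_ne x 0 with rfl | hx
  · rw [neg_zero]
  · have h2 := w.ord_mul (neg_ne_zero.2 (one_ne_zero (α := F))) hx
    rw [neg_one_mul] at h2
    omega

lemma ord_inv {x : F} (hx : x ≠ 0) : w.ord x⁻¹ = -w.ord x := by
  have := w.ord_mul hx (inv_ne_zero hx)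
  rw [mul_inv_cancel₀ hx, w.ord_one] at this
  omega

lemma ord_div {x y : F} (hx : x ≠ 0) (hy : y ≠ 0) : w.ord (x / y) = w.ord x - w.ord y := by
  rw [div_eq_mul_inv, w.ord_mul hx (inv_ne_zero hy), w.ord_inv hy, sub_eq_add_neg]

lemma ord_pow {x : F} (hx : x ≠ 0) (n : ℕ) : w.ord (x ^ n) = n * w.ord x := by
  induction n with
  | zero => simp [w.ord_one]
  | succ n ih => rw [pow_succ, w.ord_mul (pow_ne_zero n hx) hx, ih]; push_cast; ring

lemma ord_zpow {x : F} (hx : x ≠ 0) (n : ℤ) : w.ord (x ^ n) = n * w.ord x := by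
  obtain ⟨m, rfl | rfl⟩ := n.eq_nat_or_neg
  · rw [zpow_natCast, w.ord_pow hx]
  · rw [zpow_neg, zpow_natCast, w.ord_inv (pow_ne_zero m hx), w.ord_pow hx]; ring

lemma ord_prod {ι : Type*} (s : Finset ι) (t : ι → F) (h : ∀ i ∈ s, t i ≠ 0) :
    w.ord (∏ i ∈ s, t i) = ∑ i ∈ s, w.ord (t i) := by
  classical
  induction s using Finset.induction_on with
  | empty => simp [w.ord_one]
  | insert a s ha ih =>
    rw [Finset.prod_insert ha, Finset.sum_insert ha, w.ord_mul (h a (Finset.mem_insert_self a s))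
      (Finset.prod_ne_zero_iff.2 fun i hi => h i (Finset.mem_insert_of_mem hi)),
      ih fun i hi => h i (Finset.mem_insert_of_mem hi)]

variable {w}

lemma ge_iff {r : ℤ} {x : F} (hx : x ≠ 0) : w.Ge r x ↔ r ≤ w.ord x := by simp [Ge, hx]

lemma ge_zero_right (r : ℤ) : w.Ge r 0 := Or.inl rfl

lemma ge_ord (x : F) : w.Ge (w.ord x) x := Or.inr le_rfl

lemma Ge.mono {r s : ℤ} {x : F} (h : w.Ge r x) (hs : s ≤ r) : w.Ge s x := h.imp_right hs.trans

lemma Ge.add {r : ℤ} {x y : F} (hx : w.Ge r x) (hy : w.Ge r y) : w.Ge r (x + y) := by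
  rcases eq_or_ne x 0 with rfl | hx0
  · rwa [zero_add]
  rcases eq_or_ne y 0 with rfl | hy0
  · rwa [add_zero]
  rcases eq_or_ne (x + y) 0 with h | h
  · exact Or.inl h
  · exact Or.inr ((le_min ((ge_iff hx0).1 hx) ((ge_iff hy0).1 hy)).trans
      (w.min_le_ord_add' hx0 hy0 h))

lemma Ge.neg {r : ℤ} {x : F} (hx : w.Ge r x) : w.Ge r (-x) := by
  rwa [Ge, neg_eq_zero, w.ord_neg]

lemma Ge.sub {r : ℤ} {x y : F} (hx : w.Ge r x) (hy : w.Ge r y) : w.Ge r (x - y) := by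
  rw [sub_eq_add_neg]
  exact hx.add hy.neg

lemma Ge.mul {r s : ℤ} {x y : F} (hx : w.Ge r x) (hy : w.Ge s y) : w.Ge (r + s) (x * y) := by
  rcases eq_or_ne x 0 with rfl | hx0
  · rw [zero_mul]; exact ge_zero_right _
  rcases eq_or_ne y 0 with rfl | hy0
  · rw [mul_zero]; exact ge_zero_right _
  · right
    rw [w.ord_mul hx0 hy0]
    exact add_le_add ((ge_iff hx0).1 hx) ((ge_iff hy0).1 hy)

lemma Ge.pow {x : F} (hx : w.Ge 0 x) (n : ℕ) : w.Ge 0 (x ^ n) := by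
  induction n with
  | zero => rw [pow_zero, Ge, w.ord_one]; exact Or.inr le_rfl
  | succ n ih => rw [pow_succ]; simpa using ih.mul hx

lemma Ge.sum {ι : Type*} {r : ℤ} {s : Finset ι} {t : ι → F} (h : ∀ i ∈ s, w.Ge r (t i)) :
    w.Ge r (∑ i ∈ s, t i) :=
  Finset.sum_induction t (w.Ge r) (fun _ _ => Ge.add) (ge_zero_right r) h

/-- If the nonzero terms of a sum have distinct orders, they are at least as small as the sum. -/
lemma Ge.of_sum {ι : Type*} {r : ℤ} {s : Finset ι} {t : ι → F}
    (hd : ∀ i ∈ s, ∀ j ∈ s, t i ≠ 0 → t j ≠ 0 → w.ord (t i) = w.ord (t j) → i = j)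
    (h : w.Ge r (∑ i ∈ s, t i)) : ∀ i ∈ s, w.Ge r (t i) := by
  classical
  by_contra! hcon
  obtain ⟨i₀, hi₀, hlt₀⟩ := hcon
  have hne : (s.filter fun i => t i ≠ 0).Nonempty :=
    ⟨i₀, Finset.mem_filter.2 ⟨hi₀, fun h0 => hlt₀ (Or.inl h0)⟩⟩
  obtain ⟨i, hi, hmin⟩ := Finset.exists_min_image _ (fun i => w.ord (t i)) hne
  rw [Finset.mem_filter] at hi
  have hir : w.ord (t i) < r := by
    have h1 := hmin i₀ (Finset.mem_filter.2 ⟨hi₀, fun h0 => hlt₀ (Or.inl h0)⟩)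
    have h2 : ¬ r ≤ w.ord (t i₀) := fun h => hlt₀ (Or.inr h)
    omega
  have hrest : w.Ge (w.ord (t i) + 1) (∑ j ∈ s.erase i, t j) := by
    refine Ge.sum fun j hj => ?_
    rw [Finset.mem_erase] at hj
    by_cases hj0 : t j = 0
    · exact Or.inl hj0
    · have h1 := hmin j (Finset.mem_filter.2 ⟨hj.2, hj0⟩)
      have h2 : w.ord (t i) ≠ w.ord (t j) := fun h => hj.1 (hd i hi.1 j hj.2 hi.2 hj0 h).symm
      exact Or.inr (by omega)
  have hti : t i = ∑ j ∈ s, t j - ∑ j ∈ s.erase i, t j := by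
    rw [← Finset.add_sum_erase s t hi.1]; ring
  have := (h.mono (show w.ord (t i) + 1 ≤ r by omega)).sub hrest
  rw [← hti, ge_iff hi.2] at this
  omega

lemma exists_ord_eq_ord_sum {ι : Type*} {s : Finset ι} {t : ι → F}
    (hd : ∀ i ∈ s, ∀ j ∈ s, t i ≠ 0 → t j ≠ 0 → w.ord (t i) = w.ord (t j) → i = j)
    (h0 : ∑ i ∈ s, t i ≠ 0) : ∃ i ∈ s, t i ≠ 0 ∧ w.ord (t i) = w.ord (∑ i ∈ s, t i) := by
  by_contra! hcon
  have h1 := Ge.of_sum hd (ge_ord (∑ i ∈ s, t i))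
  have h2 : w.Ge (w.ord (∑ i ∈ s, t i) + 1) (∑ i ∈ s, t i) := by
    refine Ge.sum fun i hi => ?_
    rcases h1 i hi with h | h
    · exact Or.inl h
    · by_cases hi0 : t i = 0
      · exact Or.inl hi0
      · have := hcon i hi hi0
        exact Or.inr (by omega)
  rw [ge_iff h0] at h2
  omega

lemma ord_coeff_mul_pow_injOn {ϖ : F} (hϖ0 : ϖ ≠ 0) {N : ℕ}
    (hϖ : w.ord ϖ = 1) {c : ℕ → F} (hc : ∀ j, c j ≠ 0 → (N : ℤ) ∣ w.ord (c j)) :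
    ∀ i ∈ Finset.range N, ∀ j ∈ Finset.range N, c i * ϖ ^ i ≠ 0 → c j * ϖ ^ j ≠ 0 →
      w.ord (c i * ϖ ^ i) = w.ord (c j * ϖ ^ j) → i = j := by
  intro i hi j hj hi0 hj0 h
  rw [Finset.mem_range] at hi hj
  rw [w.ord_mul (left_ne_zero_of_mul hi0) (right_ne_zero_of_mul hi0),
    w.ord_mul (left_ne_zero_of_mul hj0) (right_ne_zero_of_mul hj0),
    w.ord_pow hϖ0, w.ord_pow hϖ0, hϖ] at h
  obtain ⟨u, hu⟩ := hc i (left_ne_zero_of_mul hi0)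
  obtain ⟨v, hv⟩ := hc j (left_ne_zero_of_mul hj0)
  rw [hu, hv] at h
  have h3 : (N : ℤ) ∣ j - i := ⟨u - v, by linear_combination -h⟩
  have h4 := Int.eq_zero_of_abs_lt_dvd h3 (by rw [abs_lt]; constructor <;> omega)
  omega

/-- An endomorphism `σ` of a field with `σ ^ N = 1` which preserves orders and is such that
all elements fixed by `σ` have order divisible by `N`. -/
structure IsTotRamified (w : OrdFunction F) (σ : F →+* F) (N : ℕ) : Prop where
  pos : 0 < N
  iterate_eq : ∀ x, σ^[N] x = x
  ord_map : ∀ x, w.ord (σ x) = w.ord x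
  dvd_ord : ∀ x, x ≠ 0 → σ x = x → (N : ℤ) ∣ w.ord x

namespace IsTotRamified

variable {σ : F →+* F} {N : ℕ} (h : IsTotRamified w σ N)

include h

lemma ord_iterate (k : ℕ) (x : F) : w.ord (σ^[k] x) = w.ord x := by
  induction k with
  | zero => rfl
  | succ k ih => rw [Function.iterate_succ_apply', h.ord_map, ih]

lemma ge_iterate {r : ℤ} {x : F} (hx : w.Ge r x) (k : ℕ) : w.Ge r (σ^[k] x) := by
  rcases hx with rfl | hx
  · rw [iterate_map_zero]; exact ge_zero_right r
  · exact Or.inr (by rwa [h.ord_iterate])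

omit h in
lemma iterate_ne_zero {x : F} (hx : x ≠ 0) (k : ℕ) : σ^[k] x ≠ 0 := by
  rw [← RingHom.coe_pow]
  exact (_root_.map_ne_zero _).2 hx

lemma dvd_mul_ord {x : F} (hx : x ≠ 0) {a : ℕ} (ha : σ^[a] x = x) : (N : ℤ) ∣ a * w.ord x := by
  have h1 := h.dvd_ord (∏ l ∈ Finset.range a, σ^[l] x)
    (Finset.prod_ne_zero_iff.2 fun l _ => iterate_ne_zero hx l) (by
      rw [map_prod]
      simp_rw [← Function.iterate_succ_apply' σ]
      have h2 := Finset.prod_range_succ (fun l => σ^[l] x) a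
      rw [Finset.prod_range_succ', ha, Function.iterate_zero, id] at h2
      exact mul_right_cancel₀ hx h2)
  rwa [w.ord_prod _ _ fun l _ => iterate_ne_zero hx l, Finset.sum_congr rfl
    fun l _ => h.ord_iterate l x, Finset.sum_const, Finset.card_range, nsmul_eq_mul] at h1

lemma pow {a b : ℕ} (hN : N = a * b) : IsTotRamified w (σ ^ a) b where
  pos := Nat.pos_of_ne_zero fun hb => by have := h.pos; simp [hN, hb] at this
  iterate_eq x := by rw [RingHom.coe_pow, ← Function.iterate_mul, ← hN, h.iterate_eq]
  ord_map x := h.ord_iterate a x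
  dvd_ord x hx hfix := by
    have h1 := h.dvd_mul_ord hx (a := a) hfix
    rw [hN, Nat.cast_mul] at h1
    refine Int.dvd_of_mul_dvd_mul_left ?_ h1
    have := h.pos
    rw [hN] at this
    exact_mod_cast (Nat.pos_of_mul_pos_right this).ne'

variable {ϖ : F} (hϖ : w.ord ϖ = 1) (hϖ0 : ϖ ≠ 0)

include hϖ hϖ0

lemma minimalPeriod_eq : Function.minimalPeriod σ ϖ = N := by
  refine (Function.IsPeriodicPt.minimalPeriod_dvd (h.iterate_eq ϖ)).antisymm ?_
  have h1 := h.dvd_mul_ord hϖ0 (Function.isPeriodicPt_minimalPeriod σ ϖ)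
  rw [hϖ, mul_one] at h1
  exact_mod_cast h1

lemma injOn : Set.InjOn (fun k => σ^[k] ϖ) (Finset.range N : Set ℕ) := by
  have := Function.iterate_injOn_Iio_minimalPeriod (f := σ) (x := ϖ)
  rw [h.minimalPeriod_eq hϖ hϖ0] at this
  intro a ha b hb
  exact this (by simpa using ha) (by simpa using hb)

lemma iterate_sub_ne_zero {k : ℕ} (h0 : k ≠ 0) (hk : k < N) : σ^[k] ϖ - ϖ ≠ 0 := by
  intro hs
  exact h0 (h.injOn hϖ hϖ0 (x₁ := k) (x₂ := 0) (by simpa using hk) (by simpa using h.pos)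
    (sub_eq_zero.1 hs))

omit hϖ hϖ0 in
lemma map_nodal (ϖ : F) : (Lagrange.nodal (Finset.range N) fun k => σ^[k] ϖ).map σ =
    Lagrange.nodal (Finset.range N) fun k => σ^[k] ϖ := by
  rw [Lagrange.nodal_eq, Polynomial.map_prod]
  simp only [Polynomial.map_sub, map_X, map_C, ← Function.iterate_succ_apply' σ]
  have h2 := Finset.prod_range_succ (fun l => X - C (σ^[l] ϖ)) N
  rw [Finset.prod_range_succ', h.iterate_eq, Function.iterate_zero, id] at h2
  exact mul_right_cancel₀ (X_sub_C_ne_zero ϖ) h2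

omit h hϖ hϖ0 in
lemma eval_map_iterate {P : F[X]} (hP : P.map σ = P) (x : F) (k : ℕ) :
    P.eval (σ^[k] x) = σ^[k] (P.eval x) := by
  induction k with
  | zero => rfl
  | succ k ih =>
    rw [Function.iterate_succ_apply', Function.iterate_succ_apply', ← ih]
    conv_lhs => rw [← hP]
    exact eval_map_apply ..

lemma exists_polynomial (y : F) : ∃ P : F[X], P.degree < N ∧ P.map σ = P ∧ P.eval ϖ = y ∧
    P.coeff (N - 1) = ∑ k ∈ Finset.range N,
      σ^[k] (y / ∏ l ∈ (Finset.range N).erase 0, (ϖ - σ^[l] ϖ)) := by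
  have hinj := h.injOn hϖ hϖ0
  set P := Lagrange.interpolate (Finset.range N) (fun k => σ^[k] ϖ) (fun k => σ^[k] y) with hPdef
  have hdeg : P.degree < N := by
    simpa only [Finset.card_range] using Lagrange.degree_interpolate_lt (fun k => σ^[k] y) hinj
  have heval : ∀ k, k < N → P.eval (σ^[k] ϖ) = σ^[k] y := fun k hk =>
    Lagrange.eval_interpolate_at_node (fun k => σ^[k] y) hinj (Finset.mem_range.2 hk)
  have hmap : P.map σ = P := by
    refine eq_of_degrees_lt_of_eval_index_eq (Finset.range N) hinj
      (by simpa only [Finset.card_range, degree_map] using hdeg) (by simpa using hdeg)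
      fun k hk => ?_
    obtain ⟨k', hk', hkk⟩ : ∃ k' < N, ∀ x, σ^[k] x = σ (σ^[k'] x) := by
      rw [Finset.mem_range] at hk
      rcases Nat.eq_zero_or_pos k with rfl | hk0
      · refine ⟨N - 1, by omega, fun x => ?_⟩
        rw [← Function.iterate_succ_apply' σ, Nat.succ_eq_add_one, Nat.sub_add_cancel h.pos,
          h.iterate_eq]
        rfl
      · refine ⟨k - 1, by omega, fun x => ?_⟩
        rw [← Function.iterate_succ_apply' σ, Nat.succ_eq_add_one, Nat.sub_add_cancel hk0]
    rw [heval k (Finset.mem_range.1 hk)]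
    rw [hkk, hkk, eval_map_apply, heval k' hk']
  refine ⟨P, hdeg, hmap, by simpa using heval 0 h.pos, ?_⟩
  have hc := Lagrange.coeff_eq_sum (P := P) hinj (by simpa using hdeg)
  rw [Finset.card_range] at hc
  rw [hc]
  refine Finset.sum_congr rfl fun k hk => ?_
  rw [heval k (Finset.mem_range.1 hk), ← RingHom.coe_pow, map_div₀]
  congr 1
  have hprod : ∀ k ∈ Finset.range N, ∏ j ∈ (Finset.range N).erase k, (σ^[k] ϖ - σ^[j] ϖ) =
      (derivative (Lagrange.nodal (Finset.range N) fun k => σ^[k] ϖ)).eval (σ^[k] ϖ) := by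
    intro k hk
    rw [← Lagrange.eval_nodal]
    exact (Lagrange.eval_nodal_derivative_eval_node_eq (v := fun k => σ^[k] ϖ) hk).symm
  rw [RingHom.coe_pow, hprod k hk, eval_map_iterate (by rw [← derivative_map, h.map_nodal])]
  exact congrArg _ (hprod 0 (Finset.mem_range.2 h.pos)).symm

lemma ge_iterate_sub {k : ℕ} {r : ℤ} (hk : w.Ge r (σ^[k] ϖ - ϖ)) {x : F} (hx : w.Ge 0 x) :
    w.Ge r (σ^[k] x - x) := by
  obtain ⟨P, hdeg, hmap, heval, -⟩ := h.exists_polynomial hϖ hϖ0 x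
  have hfix : ∀ j, σ (P.coeff j) = P.coeff j := fun j => by
    rw [← coeff_map, hmap]
  have hsum : ∑ j ∈ Finset.range N, P.coeff j * ϖ ^ j = x := by
    rcases eq_or_ne P 0 with rfl | hP
    · simpa using heval
    · rw [← heval, eval_eq_sum_range' ((natDegree_lt_iff_degree_lt hP).2 hdeg)]
  have hge := Ge.of_sum (ord_coeff_mul_pow_injOn hϖ0 hϖ (N := N) (c := P.coeff)
    fun j hj => h.dvd_ord _ hj (hfix j)) (hsum.symm ▸ hx)
  rw [← hsum, ← RingHom.coe_pow, map_sum, ← Finset.sum_sub_distrib]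
  refine Ge.sum fun j hj => ?_
  rw [map_mul, map_pow, RingHom.coe_pow, Function.iterate_fixed (hfix j), ← mul_sub,
    ← zero_add r]
  refine Ge.mul ?_ ?_
  · rcases eq_or_ne (P.coeff j) 0 with h0 | h0
    · exact Or.inl h0
    · have h1 := hge j hj
      rw [ge_iff (mul_ne_zero h0 (pow_ne_zero j hϖ0)), w.ord_mul h0 (pow_ne_zero j hϖ0),
        w.ord_pow hϖ0, hϖ] at h1
      obtain ⟨u, hu⟩ := h.dvd_ord _ h0 (hfix j)
      rw [hu] at h1
      rw [Finset.mem_range] at hj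
      right
      rw [hu]
      have : 0 ≤ u := by
        by_contra! hneg
        have : (N : ℤ) * u ≤ N * (-1) := mul_le_mul_of_nonneg_left (by omega) (by omega)
        omega
      positivity
  · rw [sub_eq_add_neg, ← sub_eq_add_neg, ← (Commute.all (σ^[k] ϖ) ϖ).mul_geom_sum₂, ← add_zero r]
    refine hk.mul (Ge.sum fun i _ => ?_)
    have h1 : w.Ge 0 ϖ := Or.inr (by omega)
    simpa using ((h.ge_iterate h1 k).pow i).mul (h1.pow (j - 1 - i))

/-- The residue class modulo `N` of the orders missed by the kernel of the trace is not
attained by `x ↦ σ x - x`. -/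
lemma not_dvd_add_sum {a : ℕ} (ha0 : a ≠ 0) (ha : a < N) :
    ¬ (N : ℤ) ∣ a + w.ord (σ^[a] ϖ - ϖ) +
      ∑ k ∈ (Finset.range N).erase 0, w.ord (σ^[k] ϖ - ϖ) := by
  intro hdvd
  set D := ∏ l ∈ (Finset.range N).erase 0, (ϖ - σ^[l] ϖ) with hD
  have hne : ∀ l ∈ (Finset.range N).erase 0, ϖ - σ^[l] ϖ ≠ 0 := fun l hl => by
    rw [Finset.mem_erase, Finset.mem_range] at hl
    rw [← neg_sub, neg_ne_zero]
    exact h.iterate_sub_ne_zero hϖ hϖ0 hl.1 hl.2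
  have hD0 : D ≠ 0 := Finset.prod_ne_zero_iff.2 hne
  have hordD : w.ord D = ∑ k ∈ (Finset.range N).erase 0, w.ord (σ^[k] ϖ - ϖ) := by
    rw [hD, w.ord_prod _ _ hne]
    exact Finset.sum_congr rfl fun l _ => by rw [← w.ord_neg, neg_sub]
  set x := ∏ l ∈ Finset.range a, σ^[l] ϖ with hx
  have hx0 : x ≠ 0 := Finset.prod_ne_zero_iff.2 fun l _ => iterate_ne_zero hϖ0 l
  have hordx : w.ord x = a := by
    rw [hx, w.ord_prod _ _ fun l _ => iterate_ne_zero hϖ0 l]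
    simp [h.ord_iterate, hϖ]
  have hs0 := h.iterate_sub_ne_zero hϖ hϖ0 ha0 ha
  have hz : σ x - x = x * (σ^[a] ϖ - ϖ) / ϖ := by
    have h2 := Finset.prod_range_succ (fun l => σ^[l] ϖ) a
    rw [Finset.prod_range_succ', Function.iterate_zero, id] at h2
    simp_rw [Function.iterate_succ_apply' σ] at h2
    rw [← map_prod, ← hx] at h2
    rw [eq_div_iff hϖ0]
    linear_combination h2
  have hz0 : σ x - x ≠ 0 := by
    rw [hz]; exact div_ne_zero (mul_ne_zero hx0 hs0) hϖ0
  obtain ⟨P, hdeg, hmap, heval, hcoeff⟩ := h.exists_polynomial hϖ hϖ0 ((σ x - x) * D)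
  have hfix : ∀ j, σ (P.coeff j) = P.coeff j := fun j => by
    rw [← coeff_map, hmap]
  rw [← hD, mul_div_cancel_right₀ _ hD0] at hcoeff
  have htr : P.coeff (N - 1) = 0 := by
    rw [hcoeff]
    simp_rw [← RingHom.coe_pow, map_sub]
    have := Finset.sum_range_sub (fun k => (σ ^ k) x) N
    simp only [RingHom.coe_pow, Function.iterate_succ_apply, h.iterate_eq] at this ⊢
    rw [this, Function.iterate_zero, id, sub_self]
  have hy0 := mul_ne_zero hz0 hD0
  have hP : P ≠ 0 := by rintro rfl; exact hy0 (by rw [← heval, eval_zero])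
  rw [eval_eq_sum_range' ((natDegree_lt_iff_degree_lt hP).2 hdeg)] at heval
  rw [← heval] at hy0
  obtain ⟨j, hj, hj0, hjord⟩ := exists_ord_eq_ord_sum
    (ord_coeff_mul_pow_injOn hϖ0 hϖ (N := N) (c := P.coeff)
      fun j hj => h.dvd_ord _ hj (hfix j)) hy0
  rw [heval, w.ord_mul hz0 hD0, hordD, hz, w.ord_div (mul_ne_zero hx0 hs0) hϖ0,
    w.ord_mul hx0 hs0, hordx, hϖ, w.ord_mul (left_ne_zero_of_mul hj0) (right_ne_zero_of_mul hj0),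
    w.ord_pow hϖ0, hϖ] at hjord
  obtain ⟨u, hu⟩ := h.dvd_ord _ (left_ne_zero_of_mul hj0) (hfix j)
  obtain ⟨v, hv⟩ := hdvd
  rw [hu] at hjord
  rw [Finset.mem_range] at hj
  have h3 : (N : ℤ) ∣ j + 1 := ⟨v - u, by linear_combination hjord + hv⟩
  have h4 : N ∣ j + 1 := by exact_mod_cast h3
  have h5 := Nat.le_of_dvd (by omega) h4
  have h6 : j = N - 1 := by omega
  rw [h6, htr, zero_mul] at hj0
  exact hj0 rfl

end IsTotRamified

section Congruences

variable {p : ℕ} [hp : Fact p.Prime]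

omit hp in
lemma sum_range_mul_of_not_dvd {g : ℕ → ℤ} {c : ℤ} (hpos : 0 < p) (hg : ∀ a, ¬ p ∣ a → g a = c)
    (M : ℕ) : ∑ a ∈ Finset.range (p * M), g a =
      M * (p - 1) * c + ∑ b ∈ Finset.range M, g (p * b) := by
  induction M with
  | zero => simp
  | succ M ih =>
    obtain ⟨q, rfl⟩ : ∃ q, p = q + 1 := ⟨p - 1, by omega⟩
    have h : ∀ x ∈ Finset.range q, g ((q + 1) * M + (x + 1)) = c := fun x hx => by
      apply hg
      rw [Nat.dvd_add_right (dvd_mul_right _ _)]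
      rw [Finset.mem_range] at hx
      exact Nat.not_dvd_of_pos_of_lt (by omega) (by omega)
    rw [mul_add_one, Finset.sum_range_add, ih, Finset.sum_range_succ', Finset.sum_congr rfl h,
      Finset.sum_range_succ (fun b => g ((q + 1) * b))]
    simp
    ring

lemma sum_padicValNat_succ (J : ℕ → ℤ) (n : ℕ) :
    ∑ a ∈ (Finset.range (p ^ (n + 1))).erase 0, J (padicValNat p a) =
      p ^ n * (p - 1) * J 0 +
        ∑ a ∈ (Finset.range (p ^ n)).erase 0, J (padicValNat p a + 1) := by
  have hpos := hp.out.pos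
  have hkey := sum_range_mul_of_not_dvd (p := p)
    (g := fun a => if a = 0 then 0 else J (padicValNat p a)) (c := J 0) hpos (fun a ha => by
      have : a ≠ 0 := by rintro rfl; exact ha (dvd_zero p)
      simp [this, padicValNat.eq_zero_of_not_dvd ha]) (p ^ n)
  rw [← pow_succ'] at hkey
  have h : ∀ (f : ℕ → ℤ) (N : ℕ), ∑ a ∈ (Finset.range N).erase 0, f a =
      ∑ a ∈ Finset.range N, if a = 0 then 0 else f a := fun f N => by
    rw [← Finset.filter_ne', Finset.sum_filter]
    exact Finset.sum_congr rfl fun a _ => by split_ifs <;> simp_all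
  rw [h, h, hkey]
  push_cast
  congr 1
  refine Finset.sum_congr rfl fun b _ => ?_
  rcases eq_or_ne b 0 with rfl | hb
  · simp
  · rw [if_neg (mul_ne_zero hpos.ne' hb), if_neg hb, padicValNat.mul hpos.ne' hb,
      padicValNat_self, add_comm]

lemma sum_padicValNat_add (J : ℕ → ℤ) (m : ℕ) :
    ∑ a ∈ (Finset.range (p ^ (m + 1))).erase 0, J (padicValNat p a) + J m =
      p ^ (m + 1) * J 0 + ∑ k ∈ Finset.range m, (p : ℤ) ^ (m - k) * (J (k + 1) - J k) := by
  induction m generalizing J with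
  | zero => rw [sum_padicValNat_succ]; simp; ring
  | succ m ih =>
    have := ih fun k => J (k + 1)
    rw [sum_padicValNat_succ, add_assoc, this, Finset.sum_range_succ']
    simp only [Nat.add_sub_add_right]
    simp
    ring

lemma pow_dvd_sub_of_not_dvd_add_sum (n : ℕ) : ∀ (J : ℕ → ℤ),
    (∀ s < n, ∀ a, a ≠ 0 → a < p ^ (n - s) → ¬ ((p : ℤ) ^ (n - s) ∣ a + J (padicValNat p a + s) +
      ∑ b ∈ (Finset.range (p ^ (n - s))).erase 0, J (padicValNat p b + s))) →
    ∀ k, k + 1 < n → (p : ℤ) ^ (k + 1) ∣ J (k + 1) - J k := by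
  induction n with
  | zero => intro J _ k hk; omega
  | succ n ih =>
    intro J hJ
    have ih' := ih (fun k => J (k + 1)) fun s hs a ha0 ha => by
      have := hJ (s + 1) (by omega) a ha0 (by rwa [Nat.add_sub_add_right])
      rwa [Nat.add_sub_add_right] at this
    have hstep : ∀ k < n, (p : ℤ) ^ k ∣ J (k + 1) - J k := by
      intro k hk
      rcases k with _ | k
      · simp
      · exact ih' k (by omega)
    have htel : ∀ k, ∀ l, k + l ≤ n → (p : ℤ) ^ k ∣ J (k + l) - J k := by
      intro k l
      induction l with
      | zero => simp
      | succ l ihl =>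
        intro hl
        have h1 := (pow_dvd_pow (p : ℤ) (Nat.le_add_right k l)).trans (hstep (k + l) (by omega))
        have h2 := dvd_add h1 (ihl (by omega))
        rwa [sub_add_sub_cancel] at h2
    have hsum := sum_padicValNat_add (p := p) J n
    set B := ∑ a ∈ (Finset.range (p ^ (n + 1))).erase 0, J (padicValNat p a) + J n with hB
    have hBdvd : (p : ℤ) ^ n ∣ B := by
      rw [hsum]
      refine dvd_add (Dvd.dvd.mul_right (pow_dvd_pow _ (by omega)) _)
        (Finset.dvd_sum fun k hk => ?_)
      rw [Finset.mem_range] at hk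
      have := mul_dvd_mul (dvd_refl ((p : ℤ) ^ (n - k))) (hstep k hk)
      rwa [← pow_add, Nat.sub_add_cancel hk.le] at this
    have hmain : ∀ k < n, (p : ℤ) ^ (k + 1) ∣ J n - J k := by
      intro k hk
      by_contra hnot
      have h0 : (p : ℤ) ^ k ∣ J n - J k := by
        have := htel k (n - k) (by omega)
        rwa [Nat.add_sub_cancel' hk.le] at this
      set c := J n - J k - B with hc
      have hppos : 0 < (p : ℤ) ^ (n + 1) := pow_pos (by exact_mod_cast hp.out.pos) _
      obtain ⟨a, ha⟩ := Int.eq_ofNat_of_zero_le (Int.emod_nonneg c hppos.ne')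
      have hca : (p : ℤ) ^ (n + 1) ∣ c - a := by rw [← ha]; exact Int.dvd_self_sub_emod
      have halt : a < p ^ (n + 1) := by
        have := Int.emod_lt_of_pos c hppos
        rw [ha] at this
        exact_mod_cast this
      have hac : ∀ i ≤ n, (p ^ i ∣ a ↔ (p : ℤ) ^ i ∣ J n - J k) := fun i hi => by
        have h1 : (p : ℤ) ^ i ∣ (J n - J k) - a := by
          have h2 := ((pow_dvd_pow (p : ℤ) (by omega : i ≤ n + 1)).trans hca).add
            ((pow_dvd_pow (p : ℤ) hi).trans hBdvd)
          rwa [hc, show J n - J k - B - (a : ℤ) + B = (J n - J k) - a by ring] at h2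
        rw [← Int.natCast_dvd_natCast, Nat.cast_pow]
        exact ⟨fun h => (dvd_sub_left h).1 h1, fun h => (dvd_sub_right h).1 h1⟩
      have hk1 : ¬ p ^ (k + 1) ∣ a := fun h => hnot ((hac _ hk).1 h)
      have ha0 : a ≠ 0 := by rintro rfl; exact hk1 (dvd_zero _)
      have hval : padicValNat p a = k := by
        have h1 := (padicValNat_dvd_iff_le ha0).1 ((hac _ hk.le).2 h0)
        have h2 : ¬ k + 1 ≤ padicValNat p a := fun h => hk1 ((padicValNat_dvd_iff_le ha0).2 h)
        omega
      refine hJ 0 (by omega) a ha0 halt ?_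
      simp only [Nat.sub_zero, Nat.add_zero, hval]
      rw [show (a : ℤ) + J k + ∑ b ∈ (Finset.range (p ^ (n + 1))).erase 0, J (padicValNat p b) =
        -(c - a) by rw [hc, hB]; ring]
      exact hca.neg_right
    intro k hk
    have h1 := hmain k (by omega)
    rcases Nat.lt_or_ge (k + 1) n with h | h
    · have h2 := (pow_dvd_pow (p : ℤ) (by omega : k + 1 ≤ k + 1 + 1)).trans (hmain (k + 1) h)
      have h3 := dvd_sub h1 h2
      rwa [sub_sub_sub_cancel_left] at h3
    · rwa [show n = k + 1 by omega] at h1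

lemma exists_mul_modEq {a b : ℕ} (hab : padicValNat p a ≤ padicValNat p b) (ha0 : a ≠ 0) (n : ℕ) :
    ∃ m, a * m ≡ b [MOD p ^ n] := by
  obtain ⟨a', ha'⟩ := pow_padicValNat_dvd (p := p) (n := a)
  obtain ⟨b', hb'⟩ := (pow_dvd_pow p hab).trans (pow_padicValNat_dvd (p := p) (n := b))
  have hcop : Nat.Coprime a' (p ^ n) := by
    refine Nat.Coprime.pow_right n ((Nat.coprime_comm.1 ((hp.out.coprime_iff_not_dvd).2 ?_)))
    intro hdvd
    have h1 : p ^ (padicValNat p a + 1) ∣ a := by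
      conv_rhs => rw [ha']
      rw [pow_succ]
      exact mul_dvd_mul_left _ hdvd
    have := (padicValNat_dvd_iff_le ha0).1 h1
    omega
  obtain ⟨m, -, hm⟩ := Nat.exists_mul_mod_eq_of_coprime b' hcop (pow_pos hp.out.pos n).ne'
  have h4 := Nat.ModEq.mul_left (p ^ padicValNat p a) (show a' * m ≡ b' [MOD p ^ n] from hm)
  rw [← mul_assoc, ← ha', ← hb'] at h4
  exact ⟨m, h4⟩

namespace IsTotRamified

variable {σ : F →+* F} {ϖ : F}

omit hp in
lemma ge_iterate_mul_sub {N : ℕ} (h : IsTotRamified w σ N) {r : ℤ} {a : ℕ}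
    (ha : w.Ge r (σ^[a] ϖ - ϖ)) (b : ℕ) : w.Ge r (σ^[a * b] ϖ - ϖ) := by
  induction b with
  | zero => simpa using ge_zero_right r
  | succ b ih =>
    have h1 := (h.ge_iterate ha (a * b)).add ih
    rwa [← RingHom.coe_pow σ (a * b), map_sub, RingHom.coe_pow, ← Function.iterate_add_apply,
      sub_add_sub_cancel, ← mul_add_one] at h1

lemma ge_iterate_sub_of_dvd {n : ℕ} (h : IsTotRamified w σ (p ^ n)) {r : ℤ} {a b : ℕ}
    (ha : w.Ge r (σ^[a] ϖ - ϖ)) (hab : padicValNat p a ≤ padicValNat p b) (ha0 : a ≠ 0) :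
    w.Ge r (σ^[b] ϖ - ϖ) := by
  obtain ⟨m, h2⟩ := exists_mul_modEq hab ha0 n
  have h1 := h.ge_iterate_mul_sub ha m
  have hper : Function.IsPeriodicPt σ (p ^ n) ϖ := h.iterate_eq ϖ
  rwa [← hper.iterate_mod_apply, h2, hper.iterate_mod_apply] at h1

lemma ord_iterate_sub_eq {n : ℕ} (h : IsTotRamified w σ (p ^ n)) (hϖ : w.ord ϖ = 1) (hϖ0 : ϖ ≠ 0)
    {a b : ℕ} (ha : a < p ^ n) (hb : b < p ^ n) (hab : padicValNat p a = padicValNat p b)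
    (ha0 : a ≠ 0) (hb0 : b ≠ 0) : w.ord (σ^[a] ϖ - ϖ) = w.ord (σ^[b] ϖ - ϖ) := by
  apply le_antisymm
  · exact (ge_iff (h.iterate_sub_ne_zero hϖ hϖ0 hb0 hb)).1
      (h.ge_iterate_sub_of_dvd (ge_ord _) hab.le ha0)
  · exact (ge_iff (h.iterate_sub_ne_zero hϖ hϖ0 ha0 ha)).1
      (h.ge_iterate_sub_of_dvd (ge_ord _) hab.ge hb0)

lemma ord_iterate_sub_eq_pow {n : ℕ} (h : IsTotRamified w σ (p ^ n)) (hϖ : w.ord ϖ = 1)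
    (hϖ0 : ϖ ≠ 0) {a : ℕ} (ha : a < p ^ n) (ha0 : a ≠ 0) :
    w.ord (σ^[a] ϖ - ϖ) = w.ord (σ^[p ^ padicValNat p a] ϖ - ϖ) :=
  h.ord_iterate_sub_eq hϖ hϖ0 ha
    ((Nat.le_of_dvd (Nat.pos_of_ne_zero ha0) pow_padicValNat_dvd).trans_lt ha)
    (padicValNat.prime_pow _).symm ha0 (pow_ne_zero _ hp.out.ne_zero)

/-- The Hasse–Arf theorem for a totally ramified cyclic extension of degree `p ^ (n + 1)`. -/
theorem pow_dvd_sum_add {n : ℕ} (h : IsTotRamified w σ (p ^ (n + 1))) (hϖ : w.ord ϖ = 1)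
    (hϖ0 : ϖ ≠ 0) : (p : ℤ) ^ (n + 1) ∣
      ∑ k ∈ (Finset.range (p ^ (n + 1))).erase 0, w.ord (σ^[k] ϖ - ϖ) +
        w.ord (σ^[p ^ n] ϖ - ϖ) := by
  set J : ℕ → ℤ := fun k => w.ord (σ^[p ^ k] ϖ - ϖ) with hJ
  have hord : ∀ a, a ≠ 0 → a < p ^ (n + 1) → w.ord (σ^[a] ϖ - ϖ) = J (padicValNat p a) :=
    fun a ha0 ha => h.ord_iterate_sub_eq_pow hϖ hϖ0 ha ha0
  have hcong := pow_dvd_sub_of_not_dvd_add_sum (p := p) (n + 1) J fun s hs a ha0 ha => by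
    have hs' : p ^ (n + 1) = p ^ s * p ^ (n + 1 - s) := by rw [← pow_add]; congr 1; omega
    have hterm : ∀ b, b ≠ 0 → b < p ^ (n + 1 - s) →
        w.ord ((σ ^ p ^ s)^[b] ϖ - ϖ) = J (padicValNat p b + s) := fun b hb0 hb => by
      have hps := (pow_pos hp.out.pos s)
      rw [RingHom.coe_pow, ← Function.iterate_mul, hord _ (mul_ne_zero hps.ne' hb0)
        (by rw [hs']; exact Nat.mul_lt_mul_of_pos_left hb hps), padicValNat.mul hps.ne' hb0,
        padicValNat.prime_pow, add_comm]
    have h1 := (h.pow hs').not_dvd_add_sum hϖ hϖ0 ha0 ha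
    rw [hterm a ha0 ha, Finset.sum_congr rfl fun b hb => hterm b (Finset.mem_erase.1 hb).1
      (Finset.mem_range.1 (Finset.mem_erase.1 hb).2)] at h1
    exact_mod_cast h1
  rw [Finset.sum_congr rfl fun b hb => hord b (Finset.mem_erase.1 hb).1
      (Finset.mem_range.1 (Finset.mem_erase.1 hb).2)]
  have hsum := sum_padicValNat_add (p := p) J n
  rw [hsum]
  refine dvd_add (dvd_mul_right _ _) (Finset.dvd_sum fun k hk => ?_)
  rw [Finset.mem_range] at hk
  have := mul_dvd_mul (dvd_refl ((p : ℤ) ^ (n - k))) (hcong k (by omega))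
  rwa [← pow_add, show n - k + (k + 1) = n + 1 by omega] at this

end IsTotRamified

end Congruences

/-- An order-preserving action of a group `G` on a field such that all elements fixed by `G`
have order divisible by the cardinality of `G`. -/
structure IsTotRamifiedAction (w : OrdFunction F) (G : Type*) [Group G] [MulSemiringAction G F] :
    Prop where
  ord_smul : ∀ (g : G) (x : F), w.ord (g • x) = w.ord x
  dvd_ord : ∀ x, x ≠ 0 → (∀ g : G, g • x = x) → (Nat.card G : ℤ) ∣ w.ord x

namespace IsTotRamifiedAction

section Group

variable {G : Type*} [Group G] [MulSemiringAction G F] (hG : IsTotRamifiedAction w G)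

include hG

lemma ge_smul {r : ℤ} {x : F} (hx : w.Ge r x) (g : G) : w.Ge r (g • x) := by
  rcases hx with rfl | hx
  · rw [smul_zero]; exact ge_zero_right r
  · exact Or.inr (by rwa [hG.ord_smul])

lemma subgroup [Finite G] (H : Subgroup G) : IsTotRamifiedAction w H where
  ord_smul g x := hG.ord_smul g x
  dvd_ord x hx hfix := by
    classical
    have := Fintype.ofFinite (G ⧸ H)
    let f : G ⧸ H → F := Quotient.lift (fun g : G => g • x) fun a b hab => by
      have : (a⁻¹ * b) • x = x := hfix ⟨_, QuotientGroup.leftRel_apply.1 hab⟩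
      rw [mul_smul, inv_smul_eq_iff] at this
      exact this.symm
    have hf : ∀ q, f q ≠ 0 ∧ w.ord (f q) = w.ord x := fun q => by
      induction q using QuotientGroup.induction_on with
      | H g => exact ⟨(smul_ne_zero_iff_ne g).2 hx, hG.ord_smul g x⟩
    have h1 := hG.dvd_ord (∏ q, f q) (Finset.prod_ne_zero_iff.2 fun q _ => (hf q).1) fun g => by
      rw [Finset.smul_prod']
      refine Fintype.prod_equiv (MulAction.toPerm g) _ _ fun q => ?_
      induction q using QuotientGroup.induction_on with
      | H a => exact (mul_smul g a x).symm
    rw [w.ord_prod _ _ fun q _ => (hf q).1, Finset.sum_congr rfl fun q _ => (hf q).2,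
      Finset.sum_const, Finset.card_univ, nsmul_eq_mul,
      Subgroup.card_eq_card_quotient_mul_card_subgroup H,
      ← Nat.card_eq_fintype_card, Nat.cast_mul] at h1
    exact Int.dvd_of_mul_dvd_mul_left (by exact_mod_cast Nat.card_pos.ne') h1

variable [Finite G] {π : F} (hπ : w.ord π = 1) (hπ0 : π ≠ 0)

include hπ hπ0

lemma smul_sub_ne_zero {g : G} (hg : g ≠ 1) : g • π - π ≠ 0 := by
  intro h
  have h1 := (hG.subgroup (Subgroup.zpowers g)).dvd_ord π hπ0 fun ⟨a, ha⟩ => by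
    change a • π = π
    exact (Subgroup.zpowers_le.2 (show g ∈ MulAction.stabilizer G π from sub_eq_zero.1 h)) ha
  rw [hπ, Nat.card_zpowers] at h1
  have h2 : orderOf g ∣ 1 := by exact_mod_cast h1
  exact hg (orderOf_eq_one_iff.1 (Nat.dvd_one.1 h2))

omit hπ hπ0 in
lemma isTotRamified (g : G) : IsTotRamified w (MulSemiringAction.toRingHom G F g) (orderOf g) where
  pos := orderOf_pos g
  iterate_eq x := by
    rw [show ∀ k : ℕ, (MulSemiringAction.toRingHom G F g)^[k] x = g ^ k • x from
      fun k => congrFun (smul_iterate g k) x, pow_orderOf_eq_one, one_smul]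
  ord_map x := hG.ord_smul g x
  dvd_ord x hx h := by
    rw [← Nat.card_zpowers]
    refine (hG.subgroup (Subgroup.zpowers g)).dvd_ord x hx fun ⟨a, ha⟩ => ?_
    exact (Subgroup.zpowers_le.2 (show g ∈ MulAction.stabilizer G x from h)) ha

lemma ge_smul_sub {g : G} {r : ℤ} (hg : w.Ge r (g • π - π)) {x : F} (hx : w.Ge 0 x) :
    w.Ge r (g • x - x) :=
  (hG.isTotRamified g).ge_iterate_sub hπ hπ0 (k := 1) hg hx

omit [Finite G] hπ hπ0 in
/-- The subgroup of elements moving `π` by an element of order at least `r`. -/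
def ramSubgroup (π : F) (r : ℤ) : Subgroup G where
  carrier := {g | w.Ge r (g • π - π)}
  one_mem' := by simpa using ge_zero_right r
  mul_mem' {a b} ha hb := by
    have := (hG.ge_smul hb a).add ha
    rwa [smul_sub, sub_add_sub_cancel, ← mul_smul] at this
  inv_mem' {a} ha := by
    have := (hG.ge_smul ha a⁻¹).neg
    rwa [smul_sub, inv_smul_smul, neg_sub] at this

end Group

lemma ge_coeff_prod_X_sub_C {ι : Type*} {s : Finset ι} {v : ι → F} (hv : ∀ i ∈ s, w.Ge 0 (v i))
    (k : ℕ) : w.Ge 0 ((∏ i ∈ s, (X - C (v i))).coeff k) := by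
  classical
  have h1 : w.Ge 0 1 := Or.inr w.ord_one.ge
  revert k
  induction s using Finset.induction_on with
  | empty =>
    intro k
    rw [Finset.prod_empty, coeff_one]
    split_ifs
    exacts [h1, ge_zero_right 0]
  | insert a s ha ih =>
    intro k
    rw [Finset.prod_insert ha, coeff_mul]
    refine Ge.sum fun q _ => ?_
    rw [← add_zero (0 : ℤ)]
    refine Ge.mul ?_ (ih (fun i hi => hv i (Finset.mem_insert_of_mem hi)) _)
    rw [coeff_sub, coeff_X, coeff_C]
    refine Ge.sub ?_ ?_
    · split_ifs
      exacts [h1, ge_zero_right 0]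
    · split_ifs
      exacts [hv a (Finset.mem_insert_self a s), ge_zero_right 0]

section CommGroup

variable {A : Type*} [CommGroup A] [Fintype A] [MulSemiringAction A F]
  (hA : IsTotRamifiedAction w A) {π : F} (hπ : w.ord π = 1) (hπ0 : π ≠ 0)
  (H : Subgroup A) [Fintype H]

include hA hπ hπ0

/-- Tate's formula for the ramification of the quotient by `H`. -/
lemma ord_smul_prod_sub_prod {τ : A} (hτ : τ ∉ H)
    (hne : τ • (∏ h : H, h • π) - ∏ h : H, h • π ≠ 0)
    (hge : ∀ x, (∀ h : H, h • x = x) → w.Ge 0 x →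
      w.Ge (w.ord (τ • (∏ h : H, h • π) - ∏ h : H, h • π)) (τ • x - x)) :
    w.ord (τ • (∏ h : H, h • π) - ∏ h : H, h • π) = ∑ h : H, w.ord ((τ * h) • π - π) := by
  have hge1 : w.Ge 0 π := Or.inr (by omega)
  set f : F[X] := ∏ h : H, (X - C (h • π)) with hf
  have hfmonic : f.Monic := monic_prod_of_monic _ _ fun h _ => monic_X_sub_C _
  have hfdeg : f.degree = Nat.card H := by
    rw [hf, degree_prod]
    simp [Nat.card_eq_fintype_card]
  have hcoeff : ∀ k (h : H), h • f.coeff k = f.coeff k := fun k h => by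
    have hmap : f.map (MulSemiringAction.toRingHom H F h) = f := by
      rw [hf, Polynomial.map_prod]
      refine Fintype.prod_equiv (Equiv.mulLeft h) _ _ fun h' => ?_
      simp [mul_smul]
    conv_rhs => rw [← hmap, coeff_map]
    rfl
  have hcoeff_ge : ∀ k, w.Ge 0 (f.coeff k) :=
    ge_coeff_prod_X_sub_C fun h _ => hA.ge_smul hge1 (h : A)
  set g : F[X] := f.map (MulSemiringAction.toRingHom A F τ) - f with hg
  have hgcoeff : ∀ k, g.coeff k = τ • f.coeff k - f.coeff k := fun k => by
    rw [hg, coeff_sub, coeff_map]; rfl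
  have hgdeg : g.degree < Nat.card H := by
    rw [← hfdeg]
    refine (degree_sub_lt_left (degree_map _ _) (hfmonic.map _).ne_zero ?_).trans_eq
      (degree_map _ _)
    rw [(hfmonic.map _).leadingCoeff, hfmonic.leadingCoeff]
  have hne' : ∀ h : H, (τ * h) • π - π ≠ 0 := fun h =>
    hA.smul_sub_ne_zero hπ hπ0 fun h1 => hτ <| by
      rw [eq_inv_of_mul_eq_one_left h1]
      exact H.inv_mem h.2
  have heval : g.eval π = ∏ h : H, (π - (τ * h) • π) := by
    have h0 : f.eval π = 0 := by
      rw [hf, eval_prod]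
      exact Finset.prod_eq_zero (Finset.mem_univ (1 : H)) (by simp)
    rw [hg, eval_sub, h0, sub_zero, hf, Polynomial.map_prod, eval_prod]
    refine Finset.prod_congr rfl fun h _ => ?_
    simp [mul_smul, Subgroup.smul_def]
  have hne'' : ∀ h ∈ (Finset.univ : Finset H), π - (τ * h) • π ≠ 0 := fun h _ => by
    rw [← neg_sub, neg_ne_zero]; exact hne' h
  have heval0 : g.eval π ≠ 0 := by
    rw [heval]
    exact Finset.prod_ne_zero_iff.2 hne''
  have hord : w.ord (g.eval π) = ∑ h : H, w.ord ((τ * h) • π - π) := by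
    rw [heval, w.ord_prod _ _ hne'']
    exact Finset.sum_congr rfl fun h _ => by rw [← w.ord_neg, neg_sub]
  have hg0 : g.coeff 0 = τ • (∏ h : H, h • π) - ∏ h : H, h • π ∨
      g.coeff 0 = -(τ • (∏ h : H, h • π) - ∏ h : H, h • π) := by
    have h0 : f.coeff 0 = (-1) ^ (Fintype.card H) * ∏ h : H, h • π := by
      rw [coeff_zero_eq_eval_zero, hf, eval_prod]
      simp [Finset.prod_neg]
    rw [hgcoeff, h0]
    rcases neg_one_pow_eq_or F (Fintype.card H) with h | h
    · left; rw [h, one_mul]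
    · right; rw [h, neg_one_mul, smul_neg]; ring
  have hg0ne : g.coeff 0 ≠ 0 := by
    rcases hg0 with h | h <;> rw [h]
    exacts [hne, neg_ne_zero.2 hne]
  have hg0ord : w.ord (g.coeff 0) = w.ord (τ • (∏ h : H, h • π) - ∏ h : H, h • π) := by
    rcases hg0 with h | h <;> rw [h]
    rw [w.ord_neg]
  have hgP : g ≠ 0 := by rintro h; rw [h, coeff_zero] at hg0ne; exact hg0ne rfl
  have hsum : g.eval π = ∑ k ∈ Finset.range (Nat.card H), g.coeff k * π ^ k :=
    eval_eq_sum_range' ((natDegree_lt_iff_degree_lt hgP).2 hgdeg) π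
  rw [← hord]
  apply le_antisymm
  · rw [← ge_iff heval0, hsum]
    refine Ge.sum fun k _ => ?_
    rw [← add_zero (w.ord _)]
    refine Ge.mul ?_ (hge1.pow k)
    rw [hgcoeff]
    exact hge _ (hcoeff k) (hcoeff_ge k)
  · have hall := Ge.of_sum (w := w) (ord_coeff_mul_pow_injOn hπ0 hπ (N := Nat.card H)
      (c := g.coeff) fun k hk => (hA.subgroup H).dvd_ord _ hk fun h => by
        rw [hgcoeff, smul_sub, hcoeff, Subgroup.smul_def, smul_comm, ← Subgroup.smul_def, hcoeff])
        (r := w.ord (g.eval π)) (by rw [← hsum]; exact ge_ord _) 0 (Finset.mem_range.2 Nat.card_pos)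
    rwa [pow_zero, mul_one, ge_iff hg0ne, hg0ord] at hall


end CommGroup

/-- A nontrivial element of an abelian `p`-group survives in some cyclic quotient. -/
lemma exists_cyclic_quotient {A : Type*} [CommGroup A] [Finite A] {p : ℕ} [hp : Fact p.Prime]
    (hAp : IsPGroup p A) {B : Subgroup A} {s : A} (hs : s ∉ B) :
    ∃ H : Subgroup A, B ≤ H ∧ s ∉ H ∧ ∃ (a : A) (n : ℕ),
      (∀ k : ℕ, a ^ k ∈ H ↔ p ^ (n + 1) ∣ k) ∧ ∀ g, ∃ k : ℕ, (a ^ k)⁻¹ * g ∈ H := by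
  obtain ⟨ψ, hψ⟩ := CommGroup.exists_apply_ne_one_of_hasEnoughRootsOfUnity (A ⧸ B) ℂ
    (a := (s : A ⧸ B)) (by rwa [Ne, QuotientGroup.eq_one_iff])
  set χ : A →* ℂˣ := ψ.comp (QuotientGroup.mk' B) with hχ
  have hχs : χ s ≠ 1 := hψ
  have hfin : Finite χ.range := Finite.of_surjective χ.rangeRestrict χ.rangeRestrict_surjective
  have hcyc : IsCyclic χ.range :=
    isCyclic_of_injective_ringHom ((Units.coeHom ℂ).comp χ.range.subtype)
      (Units.val_injective.comp Subtype.val_injective)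
  obtain ⟨⟨_, a, rfl⟩, ha⟩ := IsCyclic.exists_generator (α := χ.range)
  have ha' : ∀ g, ∃ k : ℕ, χ a ^ k = χ g := fun g => by
    obtain ⟨k, hk⟩ := mem_powers_iff_mem_zpowers.2 (ha ⟨χ g, g, rfl⟩)
    exact ⟨k, congrArg Subtype.val hk⟩
  obtain ⟨N, hN⟩ := IsPGroup.iff_orderOf.1 hAp a
  obtain ⟨n, -, hn⟩ := (Nat.dvd_prime_pow hp.out).1 (hN ▸ orderOf_map_dvd χ a)
  refine ⟨χ.ker, fun b hb => ?_, hχs, a, n - 1, fun k => ?_, fun g => ?_⟩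
  · change ψ (b : A ⧸ B) = 1
    rw [(QuotientGroup.eq_one_iff b).2 hb, map_one]
  · obtain rfl | h := n.eq_zero_or_pos
    · obtain ⟨k, hk⟩ := ha' s
      rw [pow_zero, orderOf_eq_one_iff] at hn
      rw [hn, one_pow] at hk
      exact absurd hk.symm hχs
    · rw [Nat.sub_add_cancel h, ← hn, orderOf_dvd_iff_pow_eq_one, MonoidHom.mem_ker, map_pow]
  · obtain ⟨k, hk⟩ := ha' g
    exact ⟨k, by rw [MonoidHom.mem_ker, map_mul, map_inv, map_pow, hk, inv_mul_cancel]⟩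

section Fixed

variable {A : Type*} [CommGroup A] [Finite A] [MulSemiringAction A F]
  (hA : IsTotRamifiedAction w A) (H : Subgroup A)

/-- The order function on the subfield fixed by `H`, normalized by the cardinality of `H`. -/
noncomputable def fixedOrd : OrdFunction (FixedPoints.subfield H F) where
  ord x := w.ord x / Nat.card H
  ord_mul' {x y} hx hy := by
    have h : ∀ z : FixedPoints.subfield H F, z ≠ 0 → (Nat.card H : ℤ) ∣ w.ord z := fun z hz =>
      (hA.subgroup H).dvd_ord _ (by simpa using hz) z.2
    rw [Subfield.coe_mul, w.ord_mul (by simpa using hx) (by simpa using hy),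
      Int.add_ediv_of_dvd_left (h x hx)]
  min_le_ord_add' {x y} hx hy hxy := by
    have := w.min_le_ord_add' (x := x) (y := y) (by simpa using hx) (by simpa using hy)
      (by exact_mod_cast hxy)
    rw [min_le_iff] at this ⊢
    have hpos : (0 : ℤ) < Nat.card H := by exact_mod_cast Nat.card_pos
    exact this.imp (Int.ediv_le_ediv hpos) (Int.ediv_le_ediv hpos)

lemma card_mul_fixedOrd {x : FixedPoints.subfield H F} (hx : x ≠ 0) :
    Nat.card H * (hA.fixedOrd H).ord x = w.ord x :=
  Int.mul_ediv_cancel' ((hA.subgroup H).dvd_ord _ (by simpa using hx) x.2)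

/-- The action of an element on the subfield fixed by `H`. -/
def fixedHom (a : A) : FixedPoints.subfield H F →+* FixedPoints.subfield H F :=
  ((MulSemiringAction.toRingHom A F a).comp (FixedPoints.subfield H F).subtype).codRestrict _
    fun x h => by
      have := x.2 h
      change (h : A) • a • (x : F) = a • x
      rw [smul_comm]
      exact congrArg _ this

omit [Finite A] in
lemma coe_iterate_fixedHom (a : A) (k : ℕ) (x : FixedPoints.subfield H F) :
    ((fixedHom H a)^[k] x : F) = a ^ k • (x : F) := by
  induction k with
  | zero => simp
  | succ k ih =>
    rw [Function.iterate_succ_apply', pow_succ', mul_smul, ← ih]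
    rfl

lemma isTotRamified_fixedHom {a : A} {N : ℕ} (hN : N * Nat.card H = Nat.card A)
    (haN : a ^ N ∈ H) (hgen : ∀ g, ∃ k : ℕ, (a ^ k)⁻¹ * g ∈ H) :
    IsTotRamified (hA.fixedOrd H) (fixedHom H a) N where
  pos := Nat.pos_of_ne_zero fun h => by
    rw [h, zero_mul] at hN
    exact Nat.card_pos.ne hN
  iterate_eq x := Subtype.ext <| by
    rw [coe_iterate_fixedHom]
    exact x.2 ⟨_, haN⟩
  ord_map x := congrArg (· / (Nat.card H : ℤ)) (hA.ord_smul a x)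
  dvd_ord x hx h := by
    have hax : a • (x : F) = x := congrArg Subtype.val h
    have h1 := hA.dvd_ord x (by simpa using hx) fun g => by
      obtain ⟨k, hk⟩ := hgen g
      have h2 : ((a ^ k)⁻¹ * g) • (x : F) = x := x.2 ⟨_, hk⟩
      rw [mul_smul, inv_smul_eq_iff] at h2
      rw [h2]
      exact (MulAction.stabilizer A (x : F)).pow_mem hax k
    rw [← card_mul_fixedOrd hA H hx, ← hN, Nat.cast_mul, mul_comm] at h1
    exact Int.dvd_of_mul_dvd_mul_left (by exact_mod_cast Nat.card_pos.ne') h1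

end Fixed

lemma orderOf_mk_eq {A : Type*} [CommGroup A] {H : Subgroup A} {a : A} {N : ℕ}
    (ha : ∀ k : ℕ, a ^ k ∈ H ↔ N ∣ k) : orderOf (a : A ⧸ H) = N := by
  have h : ∀ k, orderOf (a : A ⧸ H) ∣ k ↔ N ∣ k := fun k => by
    rw [orderOf_dvd_iff_pow_eq_one, ← QuotientGroup.mk_pow, QuotientGroup.eq_one_iff, ha]
  exact Nat.dvd_antisymm ((h N).2 dvd_rfl) ((h _).1 dvd_rfl)

lemma sum_eq_sum_range_sum {A M : Type*} [CommGroup A] [Fintype A] [AddCommMonoid M]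
    {H : Subgroup A} [Fintype H] {a : A} {N : ℕ} (hN : N ≠ 0) (ha : ∀ k : ℕ, a ^ k ∈ H ↔ N ∣ k)
    (hgen : ∀ g, ∃ k : ℕ, (a ^ k)⁻¹ * g ∈ H) (f : A → M) :
    ∑ g, f g = ∑ k ∈ Finset.range N, ∑ h : H, f (a ^ k * h) := by
  rw [← Finset.sum_product']
  symm
  refine Finset.sum_bij (fun q _ => a ^ q.1 * q.2) (fun _ _ => Finset.mem_univ _) ?_ ?_
    fun _ _ => rfl
  · rintro ⟨k, h⟩ hk ⟨l, h'⟩ hl he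
    rw [Finset.mem_product, Finset.mem_range] at hk hl
    have h1 := congrArg (QuotientGroup.mk (s := H)) he
    rw [QuotientGroup.mk_mul_of_mem _ h.2, QuotientGroup.mk_mul_of_mem _ h'.2, QuotientGroup.mk_pow,
      QuotientGroup.mk_pow, pow_eq_pow_iff_modEq, orderOf_mk_eq ha] at h1
    obtain rfl : k = l := h1.eq_of_lt_of_lt hk.1 hl.1
    exact Prod.ext rfl (Subtype.ext (mul_left_cancel he))
  · intro g _
    obtain ⟨k, hk⟩ := hgen g
    have h1 : (a ^ (k % N))⁻¹ * g ∈ H := by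
      rw [← QuotientGroup.eq] at hk ⊢
      rw [← hk, QuotientGroup.mk_pow, QuotientGroup.mk_pow, pow_eq_pow_iff_modEq, orderOf_mk_eq ha]
      exact Nat.mod_modEq k N
    exact ⟨(k % N, ⟨_, h1⟩), by simpa using Nat.mod_lt k (Nat.pos_of_ne_zero hN),
      mul_inv_cancel_left _ _⟩

section HasseArf

variable {A : Type*} [CommGroup A] [Fintype A] [MulSemiringAction A F]
  (hA : IsTotRamifiedAction w A) {π : F} (hπ : w.ord π = 1) (hπ0 : π ≠ 0)

include hA hπ hπ0

lemma le_ord_iff {r : ℤ} {g : A} (hg : g ≠ 1) :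
    r ≤ w.ord (g • π - π) ↔ g ∈ hA.ramSubgroup π r :=
  (ge_iff (hA.smul_sub_ne_zero hπ hπ0 hg)).symm

lemma card_dvd_sum_add (H : Subgroup A) [Fintype H] {p : ℕ} [hp : Fact p.Prime] {a : A} {n : ℕ}
    (ha : ∀ k : ℕ, a ^ k ∈ H ↔ p ^ (n + 1) ∣ k) (hgen : ∀ g, ∃ k : ℕ, (a ^ k)⁻¹ * g ∈ H) :
    (Nat.card A : ℤ) ∣ ∑ k ∈ (Finset.range (p ^ (n + 1))).erase 0,
      ∑ h : H, w.ord ((a ^ k * h) • π - π) + ∑ h : H, w.ord ((a ^ (p ^ n) * h) • π - π) := by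
  have hN0 : p ^ (n + 1) ≠ 0 := pow_ne_zero _ hp.out.ne_zero
  have hcard : p ^ (n + 1) * Nat.card H = Nat.card A := by
    have := sum_eq_sum_range_sum hN0 ha hgen fun _ => 1
    simpa [Nat.card_eq_fintype_card] using this.symm
  have hE := hA.isTotRamified_fixedHom H hcard ((ha _).2 dvd_rfl) hgen
  let ϖ : FixedPoints.subfield H F := ⟨∏ h : H, h • π, fun h => by
    rw [Finset.smul_prod']
    exact Fintype.prod_equiv (Equiv.mulLeft h) _ _ fun h' => (mul_smul h h' π).symm⟩
  have hne : ∀ h ∈ (Finset.univ : Finset H), h • π ≠ 0 := fun h _ => (smul_ne_zero_iff_ne h).2 hπ0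
  have hϖ0 : ϖ ≠ 0 := fun h => Finset.prod_ne_zero_iff.2 hne (congrArg Subtype.val h)
  have hϖ : (hA.fixedOrd H).ord ϖ = 1 := by
    have h1 : w.ord (ϖ : F) = Nat.card H := by
      rw [w.ord_prod _ _ hne]
      simp [hA.ord_smul, Subgroup.smul_def, hπ, Nat.card_eq_fintype_card]
    rw [← hA.card_mul_fixedOrd H hϖ0] at h1
    exact mul_left_cancel₀ (Nat.cast_ne_zero.2 Nat.card_pos.ne') (h1.trans (mul_one _).symm)
  have htate : ∀ k : ℕ, k ≠ 0 → k < p ^ (n + 1) → ∑ h : H, w.ord ((a ^ k * h) • π - π) =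
      Nat.card H * (hA.fixedOrd H).ord ((fixedHom H a)^[k] ϖ - ϖ) := fun k hk0 hk => by
    have h0 := hE.iterate_sub_ne_zero hϖ hϖ0 hk0 hk
    have hcoe : (((fixedHom H a)^[k] ϖ - ϖ : FixedPoints.subfield H F) : F) =
        a ^ k • (∏ h : H, h • π) - ∏ h : H, h • π := by
      rw [Subfield.coe_sub, coe_iterate_fixedHom]
    have hge : ∀ r (x : FixedPoints.subfield H F), (hA.fixedOrd H).Ge r x ↔
        w.Ge (Nat.card H * r) (x : F) := fun r x => by
      rcases eq_or_ne x 0 with rfl | hx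
      · exact iff_of_true (ge_zero_right _) (ge_zero_right _)
      · rw [ge_iff hx, ge_iff (by simpa using hx), ← hA.card_mul_fixedOrd H hx]
        exact (mul_le_mul_iff_right₀ (by exact_mod_cast Nat.card_pos)).symm
    rw [hA.card_mul_fixedOrd H h0, hcoe]
    symm
    refine hA.ord_smul_prod_sub_prod hπ hπ0 H ?_ ?_ ?_
    · exact fun h => hk0 (Nat.eq_zero_of_dvd_of_lt ((ha k).1 h) hk)
    · rw [← hcoe]; exact fun h => h0 (Subtype.ext h)
    · intro x hx hx0
      have := hE.ge_iterate_sub hϖ hϖ0 (ge_ord ((fixedHom H a)^[k] ϖ - ϖ)) (x := ⟨x, hx⟩)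
        ((hge _ _).2 (by rwa [mul_zero]))
      rw [hge, hA.card_mul_fixedOrd H h0, hcoe, Subfield.coe_sub, coe_iterate_fixedHom] at this
      exact this
  rw [htate _ (pow_ne_zero _ hp.out.ne_zero) (Nat.pow_lt_pow_right hp.out.one_lt n.lt_succ_self),
    Finset.sum_congr rfl fun k hk => htate k (Finset.mem_erase.1 hk).1
      (Finset.mem_range.1 (Finset.mem_erase.1 hk).2), ← Finset.mul_sum, ← mul_add, ← hcard,
    Nat.cast_mul, mul_comm (_ : ℤ)]
  refine mul_dvd_mul_left _ ?_
  exact_mod_cast hE.pow_dvd_sum_add hϖ hϖ0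

/-- The Hasse–Arf theorem for abelian `p`-groups. -/
theorem card_dvd_sum_min [DecidableEq A] {p : ℕ} [hp : Fact p.Prime] (hAp : IsPGroup p A)
    {s : A} (hs : s ≠ 1) :
    (Nat.card A : ℤ) ∣ ∑ g : A, (if g = 1 then w.ord (s • π - π) else
      min (w.ord (g • π - π)) (w.ord (s • π - π))) := by
  set j := w.ord (s • π - π) with hj
  have hsj : s ∈ hA.ramSubgroup π j := (hA.le_ord_iff hπ hπ0 hs).1 le_rfl
  have hsB : s ∉ hA.ramSubgroup π (j + 1) := by
    rw [← hA.le_ord_iff hπ hπ0 hs]; omega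
  obtain ⟨H, hBH, hsH, a, n, ha, hgen⟩ := exists_cyclic_quotient hAp hsB
  have := Fintype.ofFinite H
  have hout : ∀ g ∉ H, g ≠ 1 ∧ w.ord (g • π - π) ≤ j := fun g hg => by
    have hg1 : g ≠ 1 := fun h => hg (h ▸ H.one_mem)
    refine ⟨hg1, ?_⟩
    have : ¬ j + 1 ≤ w.ord (g • π - π) := fun h => hg (hBH ((hA.le_ord_iff hπ hπ0 hg1).1 h))
    omega
  have hN0 : p ^ (n + 1) ≠ 0 := pow_ne_zero _ hp.out.ne_zero
  obtain ⟨b, hb⟩ := hgen s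
  have hb' : ¬ p ^ (n + 1) ∣ b := fun h => hsH <| by
    have := H.mul_mem ((ha b).2 h) hb
    rwa [mul_inv_cancel_left] at this
  have hb0 : b ≠ 0 := fun h => hb' (h ▸ dvd_zero _)
  obtain ⟨m, hm⟩ := exists_mul_modEq (p := p) (a := b) (b := p ^ n) (by
    rw [padicValNat.prime_pow]
    rw [padicValNat_dvd_iff_le hb0] at hb'
    omega) hb0 (n + 1)
  set t := s ^ m with ht
  have htj : t ∈ hA.ramSubgroup π j := Subgroup.pow_mem _ hsj m
  have hta : t⁻¹ * a ^ p ^ n ∈ H := by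
    rw [← QuotientGroup.eq] at hb ⊢
    rw [ht, QuotientGroup.mk_pow, ← hb, QuotientGroup.mk_pow, QuotientGroup.mk_pow, ← pow_mul,
      pow_eq_pow_iff_modEq, orderOf_mk_eq ha]
    exact hm
  have htH : t ∉ H := fun h => by
    have := (ha (p ^ n)).1 (by simpa using H.mul_mem h hta)
    exact absurd ((Nat.pow_dvd_pow_iff_le_right hp.out.one_lt).1 this) (by omega)
  have h0 : ∑ h : H, (if (h : A) = 1 then j else min (w.ord ((h : A) • π - π)) j) =
      ∑ h : H, w.ord ((a ^ (p ^ n) * h) • π - π) := by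
    have h1 : ∑ h : H, w.ord ((a ^ (p ^ n) * h) • π - π) =
        ∑ h : H, w.ord ((t * h) • π - π) := by
      refine Fintype.sum_equiv (Equiv.mulLeft ⟨_, hta⟩) _ _ fun h => ?_
      simp [mul_assoc]
    rw [h1]
    refine Finset.sum_congr rfl fun h _ => ?_
    obtain ⟨hth1, hthj⟩ := hout (t * h) fun h' => htH ((H.mul_mem_cancel_right h.2).1 h')
    have hmem : ∀ r ≤ j, r ≤ w.ord ((t * h) • π - π) ↔ (h : A) ∈ hA.ramSubgroup π r :=
      fun r hr => by
        rw [hA.le_ord_iff hπ hπ0 hth1]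
        exact Subgroup.mul_mem_cancel_left _ (Ge.mono htj hr)
    split_ifs with hh
    · exact (hthj.antisymm ((hmem j le_rfl).2 (hh ▸ Subgroup.one_mem _))).symm
    · apply le_antisymm
      · rw [hmem _ (min_le_right _ _), ← hA.le_ord_iff hπ hπ0 hh]
        exact min_le_left _ _
      · refine le_min ?_ hthj
        rw [hA.le_ord_iff hπ hπ0 hh, ← hmem _ hthj]
  rw [sum_eq_sum_range_sum hN0 ha hgen, ← Finset.add_sum_erase _ _
    (Finset.mem_range.2 (Nat.pos_of_ne_zero hN0)), add_comm]
  simp only [pow_zero, one_mul]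
  rw [h0]
  convert hA.card_dvd_sum_add hπ hπ0 H ha hgen using 2
  refine Finset.sum_congr rfl fun k hk => Finset.sum_congr rfl fun h _ => ?_
  rw [Finset.mem_erase, Finset.mem_range] at hk
  obtain ⟨h1, h2⟩ := hout (a ^ k * h) fun h' => hk.1 <| Nat.eq_zero_of_dvd_of_lt
    ((ha k).1 ((H.mul_mem_cancel_right h.2).1 h')) hk.2
  rw [if_neg h1, min_eq_left h2]

theorem card_dvd_sum_card_ramSubgroup {p : ℕ} [hp : Fact p.Prime] (hAp : IsPGroup p A) {s : A}
    (hs : s ≠ 1) {n : ℕ} (hn : w.ord (s • π - π) = n) :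
    Nat.card A ∣ ∑ r ∈ Finset.range n, Nat.card (hA.ramSubgroup π (r + 1)) := by
  classical
  have h := hA.card_dvd_sum_min hπ hπ0 hAp hs
  have hcount : ∀ k : ℤ, 0 ≤ k →
      ∑ r ∈ Finset.range n, (if (r : ℤ) + 1 ≤ k then 1 else 0) = min k n := fun k hk => by
    rw [Finset.sum_ite, Finset.sum_const_zero, add_zero, Finset.sum_const, nsmul_eq_mul, mul_one]
    lift k to ℕ using hk
    have : (Finset.range n).filter (fun r : ℕ => (r : ℤ) + 1 ≤ k) = Finset.range (min k n) := by
      ext r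
      simp only [Finset.mem_filter, Finset.mem_range]
      omega
    rw [this, Finset.card_range, Nat.cast_min]
  have hsum : ((∑ r ∈ Finset.range n, Nat.card (hA.ramSubgroup π (r + 1)) : ℕ) : ℤ) =
      ∑ g : A, (if g = 1 then w.ord (s • π - π) else
        min (w.ord (g • π - π)) (w.ord (s • π - π))) := by
    have hc : ∀ r : ℕ, (Nat.card (hA.ramSubgroup π (r + 1)) : ℤ) =
        ∑ g : A, if g ∈ hA.ramSubgroup π (r + 1) then 1 else 0 := fun r => by
      rw [Finset.sum_boole, Nat.card_eq_fintype_card, Fintype.card_subtype]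
    rw [Nat.cast_sum, Finset.sum_congr rfl fun r _ => hc r, Finset.sum_comm]
    refine Finset.sum_congr rfl fun g _ => ?_
    split_ifs with hg
    · subst hg
      simp [hn]
    · simp_rw [← hA.le_ord_iff hπ hπ0 hg]
      rw [hcount _ ?_, hn]
      rw [← ge_iff (hA.smul_sub_ne_zero hπ hπ0 hg)]
      have hge : w.Ge 0 π := Or.inr (by omega)
      exact (hA.ge_smul hge g).sub hge
  rw [← hsum] at h
  exact_mod_cast h

end HasseArf

end IsTotRamifiedAction

section Galois

variable {K L : Type*} [Field K] [Field L] [Algebra K L] [FiniteDimensional K L] [IsGalois K L]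
  {w : OrdFunction L}

lemma exists_ge_trace (hσ : ∀ (σ : L ≃ₐ[K] L) x, w.ord (σ x) = w.ord x) {r : ℤ} {x : L}
    (hx : w.Ge r x) : w.Ge r (algebraMap K L (Algebra.trace K L x)) := by
  rw [trace_eq_sum_automorphisms]
  refine Ge.sum fun σ _ => ?_
  rcases hx with rfl | hx
  · rw [map_zero]; exact ge_zero_right r
  · exact Or.inr (by rwa [hσ])

/-- A subspace approximating all elements arbitrarily well is the whole space. -/
lemma eq_top_of_dense (hσ : ∀ (σ : L ≃ₐ[K] L) x, w.ord (σ x) = w.ord x) (M : Submodule K L)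
    (hM : ∀ x (r : ℤ), ∃ y ∈ M, w.Ge r (x - y)) : M = ⊤ := by
  by_contra hne
  obtain ⟨f, hf0, hf⟩ := M.exists_le_ker_of_lt_top (lt_top_iff_ne_top.2 hne)
  have hnd := traceForm_nondegenerate K L
  set z := ((Algebra.traceForm K L).toDual hnd).symm f with hz
  have hfz : ∀ x, f x = Algebra.trace K L (z * x) := fun x => by
    rw [← Algebra.traceForm_apply, hz, LinearMap.BilinForm.apply_toDual_symm_apply]
  refine hf0 (LinearMap.ext fun x => ?_)
  by_contra hfx
  rw [LinearMap.zero_apply] at hfx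
  have hfx' : algebraMap K L (f x) ≠ 0 := by simpa using hfx
  obtain ⟨y, hy, hxy⟩ := hM x (w.ord (algebraMap K L (f x)) + 1 - w.ord z)
  have h1 : f x = Algebra.trace K L (z * (x - y)) := by
    rw [← hfz, map_sub, LinearMap.mem_ker.1 (hf hy), sub_zero]
  have h2 := exists_ge_trace hσ ((ge_ord z).mul hxy)
  rw [← h1, ge_iff hfx'] at h2
  omega

lemma finrank_le_of_ord (hσ : ∀ (σ : L ≃ₐ[K] L) x, w.ord (σ x) = w.ord x)
    (hres : ∀ x, w.Ge 0 x → ∃ a : K, w.Ge 1 (x - algebraMap K L a)) {π : L} (hπ : w.ord π = 1)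
    (hπ0 : π ≠ 0) {c : K} (hc : c ≠ 0) {e : ℕ} (he : 0 < e)
    (hce : w.ord (algebraMap K L c) = e) : Module.finrank K L ≤ e := by
  have hc' : algebraMap K L c ≠ 0 := by simpa using hc
  set M := Submodule.span K (Set.range fun i : Fin e => π ^ (i : ℕ)) with hM
  have hstep : ∀ x (r : ℤ), w.Ge r x → ∃ y ∈ M, w.Ge (r + 1) (x - y) := by
    intro x r hx
    obtain rfl | hx0 := eq_or_ne x 0
    · exact ⟨0, M.zero_mem, by rw [sub_zero]; exact ge_zero_right _⟩
    set i := (r % e).toNat with hi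
    have hr : (i : ℤ) = r % e := Int.toNat_of_nonneg (Int.emod_nonneg _ (by omega))
    have hie : i < e := by have := Int.emod_lt_of_pos r (b := e) (by omega); omega
    set d := algebraMap K L c ^ (r / e) * π ^ i with hd
    have hd0 : d ≠ 0 := mul_ne_zero (zpow_ne_zero _ hc') (pow_ne_zero _ hπ0)
    have hdo : w.ord d = r := by
      rw [hd, w.ord_mul (zpow_ne_zero _ hc') (pow_ne_zero _ hπ0), w.ord_zpow hc', w.ord_pow hπ0,
        hce, hπ, hr, mul_one, mul_comm]
      exact Int.mul_ediv_add_emod r e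
    obtain ⟨a, ha⟩ := hres (x / d) (Or.inr (by
      rw [w.ord_div hx0 hd0, hdo]
      have := (ge_iff hx0).1 hx
      omega))
    refine ⟨algebraMap K L a * d, ?_, ?_⟩
    · have : algebraMap K L a * d = (a * c ^ (r / e)) • π ^ i := by
        rw [Algebra.smul_def, map_mul, map_zpow₀, mul_assoc]
      rw [this]
      exact M.smul_mem _ (Submodule.subset_span ⟨⟨i, hie⟩, rfl⟩)
    · have h1 := (ge_ord d).mul ha
      rwa [hdo, mul_sub, mul_div_cancel₀ _ hd0, mul_comm d] at h1
  have hdense : ∀ x (r : ℤ), ∃ y ∈ M, w.Ge r (x - y) := by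
    intro x r
    have hind : ∀ n : ℕ, ∃ y ∈ M, w.Ge (w.ord x + n) (x - y) := by
      intro n
      induction n with
      | zero => exact ⟨0, M.zero_mem, by simpa using ge_ord x⟩
      | succ n ih =>
        obtain ⟨y, hy, hxy⟩ := ih
        obtain ⟨y', hy', hxy'⟩ := hstep _ _ hxy
        refine ⟨y + y', M.add_mem hy hy', ?_⟩
        rwa [sub_sub, add_assoc, ← Nat.cast_succ] at hxy'
    obtain ⟨y, hy, hxy⟩ := hind (r - w.ord x).toNat
    exact ⟨y, hy, hxy.mono (by omega)⟩
  have htop := eq_top_of_dense hσ M hdense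
  rw [← finrank_top K L, ← htop]
  exact (finrank_range_le_card _).trans_eq (Fintype.card_fin e)

/-- A Galois extension with trivial residue extension is totally ramified. -/
theorem isTotRamifiedAction_of_residue (hσ : ∀ (σ : L ≃ₐ[K] L) x, w.ord (σ x) = w.ord x)
    (hres : ∀ x, w.Ge 0 x → ∃ a : K, w.Ge 1 (x - algebraMap K L a)) {π : L} (hπ : w.ord π = 1)
    (hπ0 : π ≠ 0) : IsTotRamifiedAction w (L ≃ₐ[K] L) where
  ord_smul := hσ
  dvd_ord x hx hfix := by
    rw [IsGalois.card_aut_eq_finrank]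
    let S : AddSubgroup ℤ :=
      { carrier := {r | ∃ c : K, c ≠ 0 ∧ w.ord (algebraMap K L c) = r}
        zero_mem' := ⟨1, one_ne_zero, by rw [map_one, w.ord_one]⟩
        add_mem' := by
          rintro _ _ ⟨c, hc, rfl⟩ ⟨d, hd, rfl⟩
          exact ⟨c * d, mul_ne_zero hc hd, by
            rw [map_mul, w.ord_mul (by simpa using hc) (by simpa using hd)]⟩
        neg_mem' := by
          rintro _ ⟨c, hc, rfl⟩
          exact ⟨c⁻¹, inv_ne_zero hc, by rw [map_inv₀, w.ord_inv (by simpa using hc)]⟩ }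
    obtain ⟨e, he⟩ := Int.subgroup_cyclic S
    have hS : ∀ r, r ∈ S ↔ (e.natAbs : ℤ) ∣ r := fun r => by
      rw [he, AddSubgroup.mem_closure_singleton, Int.natAbs_dvd]
      simp [dvd_def, eq_comm, mul_comm]
    have hn : (Module.finrank K L : ℤ) ∈ S := by
      refine ⟨Algebra.norm K π, by simpa using hπ0, ?_⟩
      rw [Algebra.norm_eq_prod_automorphisms, w.ord_prod _ _ fun σ _ => by simpa using hπ0,
        Finset.sum_congr rfl fun σ _ => (hσ σ π).trans hπ, ← IsGalois.card_aut_eq_finrank]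
      simp [Nat.card_eq_fintype_card]
    have hpos : 0 < Module.finrank K L := Module.finrank_pos
    have he0 : 0 < e.natAbs := Nat.pos_of_ne_zero fun h => by
      rw [hS, h] at hn
      simp at hn
      omega
    obtain ⟨c, hc, hce⟩ := (hS _).2 (dvd_refl (e.natAbs : ℤ))
    have hle := finrank_le_of_ord hσ hres hπ hπ0 hc he0 hce
    have hdvd := (hS _).1 hn
    have heq : e.natAbs = Module.finrank K L :=
      Nat.le_antisymm (Nat.le_of_dvd hpos (by exact_mod_cast hdvd)) hle
    obtain ⟨d, rfl⟩ := (IsGalois.mem_range_algebraMap_iff_fixed x).2 hfix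
    rw [← heq, ← hS]
    exact ⟨d, by simpa using hx, rfl⟩

end Galois

/-- The order function attached to a `ℤ`-valued valuation. -/
def ofValuation {L : Type*} [Field L] (v : Valuation L (WithZero (Multiplicative ℤ))) :
    OrdFunction L where
  ord x := -WithZero.log (v x)
  ord_mul' {x y} hx hy := by
    rw [map_mul, WithZero.log_mul (v.ne_zero_iff.2 hx) (v.ne_zero_iff.2 hy), neg_add]
  min_le_ord_add' {x y} hx hy hxy := by
    have h := v.map_add x y
    rw [le_max_iff, ← WithZero.log_le_log (v.ne_zero_iff.2 hxy) (v.ne_zero_iff.2 hx),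
      ← WithZero.log_le_log (v.ne_zero_iff.2 hxy) (v.ne_zero_iff.2 hy)] at h
    omega

lemma ge_ofValuation_iff {L : Type*} [Field L] {v : Valuation L (WithZero (Multiplicative ℤ))}
    {r : ℤ} {x : L} : (ofValuation v).Ge r x ↔ v x ≤ WithZero.exp (-r) := by
  rcases eq_or_ne x 0 with rfl | hx
  · exact iff_of_true (ge_zero_right r) (by rw [map_zero]; exact zero_le)
  · rw [ge_iff hx, ← WithZero.log_le_iff_le_exp (v.ne_zero_iff.2 hx)]
    exact le_neg

section Residue

open IsLocalRing

variable {K L Γ : Type*} [Field K] [Field L] [Algebra K L] [LinearOrderedCommGroupWithZero Γ]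
  {vL : Valuation L Γ}

/-- The action of the Galois group on the valuation ring of an invariant valuation. -/
@[reducible]
def mulSemiringActionValuationSubring (hGal : ∀ (σ : L ≃ₐ[K] L) (x : L), vL (σ x) = vL x) :
    MulSemiringAction (L ≃ₐ[K] L) vL.valuationSubring where
  smul σ x := ⟨σ x, (hGal σ x).le.trans x.2⟩
  one_smul _ := rfl
  mul_smul _ _ _ := rfl
  smul_zero σ := Subtype.ext (map_zero σ)
  smul_add σ _ _ := Subtype.ext (map_add σ _ _)
  smul_one σ := Subtype.ext (map_one σ)
  smul_mul σ _ _ := Subtype.ext (map_mul σ _ _)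

/-- Over an algebraically closed residue field, integral elements are congruent to elements of
the base field. -/
lemma exists_valuation_sub_lt_one [FiniteDimensional K L] [IsGalois K L] {Γ' : Type*}
    [LinearOrderedCommGroupWithZero Γ'] (vK : Valuation K Γ') [vK.HasExtension vL]
    [IsAlgClosed (ResidueField vK.valuationSubring)]
    (hGal : ∀ (σ : L ≃ₐ[K] L) (x : L), vL (σ x) = vL x) {x : L} (hx : vL x ≤ 1) :
    ∃ a : K, vL (x - algebraMap K L a) < 1 := by
  let _ := mulSemiringActionValuationSubring hGal
  have hinv : Algebra.IsInvariant vK.valuationSubring vL.valuationSubring (L ≃ₐ[K] L) := ⟨by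
    rintro ⟨b, hb⟩ h
    obtain ⟨a, rfl⟩ := (IsGalois.mem_range_algebraMap_iff_fixed b).2 fun σ =>
      congrArg Subtype.val (h σ)
    exact ⟨⟨a, (Valuation.HasExtension.val_map_le_one_iff vK vL a).1 hb⟩, rfl⟩⟩
  have hinteg : Algebra.IsIntegral vK.valuationSubring vL.valuationSubring :=
    hinv.isIntegral _ _ (L ≃ₐ[K] L)
  have hinteg' : Algebra.IsIntegral (ResidueField vK.valuationSubring)
      (ResidueField vL.valuationSubring) := by
    refine ⟨fun y => ?_⟩
    obtain ⟨b, rfl⟩ := residue_surjective y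
    exact ((hinteg.isIntegral b).map (IsScalarTower.toAlgHom vK.valuationSubring
      vL.valuationSubring (ResidueField vL.valuationSubring))).tower_top
  obtain ⟨r, hr⟩ := (IsAlgClosed.algebraMap_bijective_of_isIntegral
    (k := ResidueField vK.valuationSubring)).2 (residue vL.valuationSubring ⟨x, hx⟩)
  obtain ⟨a, rfl⟩ := residue_surjective r
  refine ⟨a, ?_⟩
  rw [Valuation.HasExtension.algebraMap_residue_eq_residue_algebraMap, eq_comm,
    ← sub_eq_zero, ← map_sub, residue_eq_zero_iff, Valuation.mem_maximalIdeal_iff] at hr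
  exact hr

end Residue

namespace IsTotRamifiedAction

/-- An element acting trivially modulo terms of order at least `2` and of order invertible in the
residue field is trivial. -/
lemma eq_one_of_mem_ramSubgroup_two {F G : Type*} [Field F] {w : OrdFunction F} [Group G] [Finite G]
    [MulSemiringAction G F] (hG : IsTotRamifiedAction w G) {π : F} (hπ : w.ord π = 1)
    (hπ0 : π ≠ 0) {g : G} (hg : g ∈ hG.ramSubgroup π 2) (hu : ¬ w.Ge 1 (orderOf g : F)) :
    g = 1 := by
  set q := orderOf g with hq
  set z := ∑ l ∈ Finset.range q, g ^ l • π with hz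
  have hfix : g • z = z := by
    have h := Finset.sum_range_succ (fun l => g ^ l • π) q
    rw [Finset.sum_range_succ', pow_orderOf_eq_one, pow_zero] at h
    rw [hz, Finset.smul_sum]
    simp_rw [← mul_smul, ← pow_succ']
    exact add_right_cancel h
  have hzπ : w.Ge 2 (z - q * π) := by
    have : z - q * π = ∑ l ∈ Finset.range q, (g ^ l • π - π) := by
      rw [Finset.sum_sub_distrib, Finset.sum_const, Finset.card_range, nsmul_eq_mul]
    rw [this]
    exact Ge.sum fun l _ => (hG.ramSubgroup π 2).pow_mem hg l
  have h2 : ¬ w.Ge 2 z := fun h => hu <| by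
    have h3 := (h.sub hzπ).mul (ge_ord π⁻¹)
    rwa [w.ord_inv hπ0, hπ, sub_sub_cancel, mul_inv_cancel_right₀ hπ0] at h3
  have h1 : w.Ge 1 z := by
    have hge : w.Ge 1 π := Or.inr hπ.ge
    exact Ge.sum fun l _ => hG.ge_smul hge _
  have hz0 : z ≠ 0 := fun h => h2 (Or.inl h)
  have hz1 : w.ord z = 1 := by
    rw [ge_iff hz0] at h1 h2
    omega
  have h3 := (hG.isTotRamified g).dvd_ord z hz0 hfix
  rw [hz1] at h3
  exact orderOf_eq_one_iff.1 (Nat.dvd_one.1 (by exact_mod_cast h3))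

lemma isPGroup_ramSubgroup_two {F G : Type*} [Field F] {w : OrdFunction F} [Group G] [Finite G]
    [MulSemiringAction G F] (hG : IsTotRamifiedAction w G) {π : F} (hπ : w.ord π = 1)
    (hπ0 : π ≠ 0) {p : ℕ} (hp : p.Prime) (hpF : w.Ge 1 (p : F)) :
    IsPGroup p (hG.ramSubgroup π 2) := by
  rintro ⟨g, hg⟩
  obtain ⟨k, q, hpq, hk⟩ := Nat.exists_eq_pow_mul_and_not_dvd (orderOf_pos g).ne' p hp.ne_one
  have hnat : ∀ n : ℕ, w.Ge 0 (n : F) := fun n => by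
    rw [← nsmul_one, ← Finset.card_range n, ← Finset.sum_const]
    exact Ge.sum fun _ _ => Or.inr w.ord_one.ge
  have hinteg : ∀ n : ℤ, w.Ge 0 (n : F) := fun n => by
    obtain ⟨m, rfl | rfl⟩ := n.eq_nat_or_neg
    · rw [Int.cast_natCast]; exact hnat m
    · rw [Int.cast_neg, Int.cast_natCast]; exact (hnat m).neg
  have hord : orderOf (g ^ p ^ k) = q := by
    rw [orderOf_pow_of_dvd (pow_ne_zero k hp.ne_zero) (hk ▸ dvd_mul_right _ _), hk,
      Nat.mul_div_cancel_left _ (pow_pos hp.pos k)]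
  refine ⟨k, Subtype.ext (hG.eq_one_of_mem_ramSubgroup_two hπ hπ0
    ((hG.ramSubgroup π 2).pow_mem hg _) ?_)⟩
  change ¬ w.Ge 1 (orderOf (g ^ p ^ k) : F)
  rw [hord]
  intro h
  have hcop : Nat.Coprime p q := (Nat.Prime.coprime_iff_not_dvd hp).2 hpq
  have h1 : w.Ge 1 (1 : F) := by
    have h2 : (1 : F) = p * (p.gcdA q : ℤ) + q * (p.gcdB q : ℤ) := by
      have := Nat.gcd_eq_gcd_ab p q
      rw [hcop.gcd_eq_one] at this
      exact_mod_cast congrArg (Int.cast : ℤ → F) this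
    rw [h2, ← add_zero (1 : ℤ)]
    exact (hpF.mul (hinteg _)).add (h.mul (hinteg _))
  rw [ge_iff one_ne_zero, w.ord_one] at h1
  omega

end IsTotRamifiedAction

namespace IsTotRamifiedAction

theorem card_dvd_sum_card_ramSubgroup_of_le {F G : Type*} [Field F] {w : OrdFunction F} [Group G]
    [Finite G] [MulSemiringAction G F] (hG : IsTotRamifiedAction w G) {π : F} (hπ : w.ord π = 1)
    (hπ0 : π ≠ 0) {P : Subgroup G} (hab : ∀ x y : P, x * y = y * x) {p : ℕ} [Fact p.Prime]
    (hP : IsPGroup p P) (hle : hG.ramSubgroup π 2 ≤ P) {s : G} (hsP : s ∈ P) (hs : s ≠ 1) {j : ℕ}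
    (hj : w.ord (s • π - π) = j + 1) :
    Nat.card P ∣ ∑ r ∈ Finset.range j, Nat.card (hG.ramSubgroup π (r + 2)) := by
  have := Fintype.ofFinite P
  let _ : CommGroup P := { (inferInstance : Group P) with mul_comm := hab }
  have hA : IsTotRamifiedAction w P := hG.subgroup P
  have h := hA.card_dvd_sum_card_ramSubgroup hπ hπ0 (p := p) hP (s := ⟨s, hsP⟩)
    (fun h => hs (congrArg Subtype.val h)) (n := j + 1) (by exact_mod_cast hj)
  have h0 : hA.ramSubgroup π ((0 : ℕ) + 1) = ⊤ := by
    have hge : w.Ge 1 π := Or.inr hπ.ge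
    exact eq_top_iff.2 fun g _ => (hA.ge_smul hge g).sub hge
  have hcard : ∀ r : ℕ, Nat.card (hA.ramSubgroup π ((r + 1 : ℕ) + 1)) =
      Nat.card (hG.ramSubgroup π (r + 2)) := fun r => by
    have hr : hG.ramSubgroup π (r + 2) ≤ P := fun g hg => hle (Ge.mono hg (by omega))
    rw [← Nat.card_congr (Subgroup.subgroupOfEquivOfLe hr).toEquiv, Nat.cast_succ, add_assoc,
      one_add_one_eq_two]
    rfl
  rw [Finset.sum_range_succ', h0, Subgroup.card_top,
    Finset.sum_congr rfl fun r _ => hcard r] at h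
  exact (Nat.dvd_add_iff_left dvd_rfl).2 h

end IsTotRamifiedAction

end OrdFunction

open OrdFunction

/-- Let `K` be a complete discrete valuation field with algebraically closed residue field of
characteristic `p > 0`, and let `L/K` be a finite Galois extension with group
`G ≅ P ⋊ ℤ/m`, where `P` is the `p`-Sylow subgroup of `G` and `p ∤ m`.  If `P` is abelian,
then every upper-numbering jump of the ramification filtration of `L/K` (the upper jump
corresponding to a lower jump `j` being `φ(j)`) lies in `(1/m)ℤ`. -/
theorem stmt_5 {p m : ℕ} (hp : p.Prime) (hm : ¬ p ∣ m)
    {K L : Type*} [Field K] [Field L] [Algebra K L] [FiniteDimensional K L] [IsGalois K L]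
    (vK : Valuation K (WithZero (Multiplicative ℤ)))
    (vL : Valuation L (WithZero (Multiplicative ℤ)))
    -- `K` and `L` carry normalized (surjective) discrete valuations:
    (hvK : Function.Surjective vK) (hvL : Function.Surjective vL)
    -- `K` is complete:
    (hcomplete : IsAdicComplete (IsLocalRing.maximalIdeal vK.valuationSubring)
      vK.valuationSubring)
    -- the residue field of `K` is algebraically closed of characteristic `p`:
    (hres : IsAlgClosed (IsLocalRing.ResidueField vK.valuationSubring))
    (hchar : CharP (IsLocalRing.ResidueField vK.valuationSubring) p)
    -- `vL` extends `vK`: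
    (hext : ∀ x : K, vL (algebraMap K L x) ≤ 1 ↔ vK x ≤ 1)
    -- `vL` is invariant under the Galois action:
    (hGal : ∀ (σ : L ≃ₐ[K] L) (x : L), vL (σ x) = vL x)
    -- `Gal(L/K) ≅ P ⋊ ℤ/m` with `P` the (abelian) `p`-Sylow subgroup and `p ∤ m`:
    (P : Sylow p (L ≃ₐ[K] L)) (hPnorm : (P : Subgroup (L ≃ₐ[K] L)).Normal)
    (habel : ∀ x y : ↥(P : Subgroup (L ≃ₐ[K] L)), x * y = y * x)
    (T : Subgroup (L ≃ₐ[K] L)) (hT : IsCyclic ↥T) (hTcard : Nat.card ↥T = m)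
    (hcompl : Subgroup.IsComplement' (P : Subgroup (L ≃ₐ[K] L)) T) :
    ∀ j : ℕ, ramificationGroup vL hGal j ≠ ramificationGroup vL hGal (j + 1) →
      ∃ z : ℤ, herbrandPhi vL hGal j = (z : ℚ) / (m : ℚ) := by
  have := Fact.mk hp
  set w := ofValuation vL with hw
  have hextn : vK.HasExtension vL := ⟨Valuation.isEquiv_iff_val_le_one.2 fun {x} => (hext x).symm⟩
  have hone : ∀ x : L, vL x < 1 → w.Ge 1 x := fun x hx => by
    rcases eq_or_ne x 0 with rfl | hx0
    · exact ge_zero_right 1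
    · rw [← WithZero.exp_zero, ← WithZero.log_lt_iff_lt_exp (vL.ne_zero_iff.2 hx0)] at hx
      exact Or.inr (Int.add_one_le_of_lt (neg_pos.2 hx))
  have hσ : ∀ (σ : L ≃ₐ[K] L) x, w.ord (σ x) = w.ord x := fun σ x => by
    change -WithZero.log _ = -WithZero.log _
    rw [hGal]
  have hresidue : ∀ x, w.Ge 0 x → ∃ a : K, w.Ge 1 (x - algebraMap K L a) := fun x hx => by
    rw [ge_ofValuation_iff, neg_zero, WithZero.exp_zero] at hx
    exact (exists_valuation_sub_lt_one vK hGal hx).imp fun a ha => hone _ ha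
  obtain ⟨π, hvπ⟩ := hvL (WithZero.exp (-1))
  have hπ0 : π ≠ 0 := by
    rintro rfl
    rw [map_zero] at hvπ
    exact WithZero.exp_ne_zero hvπ.symm
  have hπ : w.ord π = 1 := by
    change -WithZero.log (vL π) = 1
    rw [hvπ, WithZero.log_exp, neg_neg]
  have hG := isTotRamifiedAction_of_residue hσ hresidue hπ hπ0
  have hram : ∀ r : ℕ, ramificationGroup vL hGal r = hG.ramSubgroup π (r + 1) := fun r => by
    ext σ
    constructor
    · intro h
      refine ge_ofValuation_iff.2 (h π ?_)
      rw [hvπ, ← WithZero.exp_zero, WithZero.exp_le_exp]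
      omega
    · intro h x hx
      refine ge_ofValuation_iff.1 (hG.ge_smul_sub hπ hπ0 h (ge_ofValuation_iff.2 ?_))
      rwa [neg_zero, WithZero.exp_zero]
  have htop : ramificationGroup vL hGal 0 = ⊤ := by
    rw [hram]
    have hge : w.Ge 1 π := Or.inr hπ.ge
    exact eq_top_iff.2 fun g _ => (hG.ge_smul hge g).sub hge
  have hpL : w.Ge 1 (p : L) := by
    have h : vK (p : vK.valuationSubring) < 1 := by
      rw [← Valuation.mem_maximalIdeal_iff, ← IsLocalRing.residue_eq_zero_iff, map_natCast]
      exact CharP.cast_eq_zero _ p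
    refine hone _ ?_
    rw [← map_natCast (algebraMap K L), Valuation.HasExtension.val_map_lt_one_iff vK vL]
    exact_mod_cast h
  have hle : hG.ramSubgroup π 2 ≤ P := by
    obtain ⟨Q, hQ⟩ := (hG.isPGroup_ramSubgroup_two hπ hπ0 hp hpL).exists_le_sylow
    have := Sylow.unique_of_normal P hPnorm
    rwa [Subsingleton.elim P Q]
  have hcard : (Nat.card (L ≃ₐ[K] L) : ℚ) = Nat.card P * m := by
    rw [← hTcard]
    exact_mod_cast hcompl.card_mul_card.symm
  have hP0 : (Nat.card P : ℚ) ≠ 0 := Nat.cast_ne_zero.2 Nat.card_pos.ne'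
  intro j hj
  suffices h : Nat.card P ∣ ∑ r ∈ Finset.range j, Nat.card (hG.ramSubgroup π (r + 2)) by
    obtain ⟨z, hz⟩ := h
    refine ⟨z, ?_⟩
    have hsum : ∑ r ∈ Finset.range j, (Nat.card (ramificationGroup vL hGal (r + 1)) : ℚ) =
        Nat.card P * z := by
      rw [← Nat.cast_mul, ← hz, Nat.cast_sum]
      refine Finset.sum_congr rfl fun r _ => ?_
      rw [hram, Nat.cast_succ, add_assoc, one_add_one_eq_two]
    rw [herbrandPhi, hsum, htop, Subgroup.card_top, hcard, mul_div_mul_left _ _ hP0]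
    rfl
  obtain rfl | hj0 := j.eq_zero_or_pos
  · simp
  obtain ⟨s, hsj, hsj'⟩ := SetLike.exists_of_lt (lt_of_le_of_ne (fun g hg => by
    rw [hram] at hg ⊢
    exact Ge.mono hg (by push_cast; omega)) hj.symm)
  have hs1 : s ≠ 1 := fun h => hsj' (h ▸ Subgroup.one_mem _)
  have hne := hG.smul_sub_ne_zero hπ hπ0 hs1
  rw [hram] at hsj hsj'
  refine hG.card_dvd_sum_card_ramSubgroup_of_le hπ hπ0 habel P.isPGroup' hle
    (hle (Ge.mono hsj (by omega))) hs1 ?_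
  have h1 := (ge_iff hne).1 hsj
  have h2 := mt (ge_iff hne).2 hsj'
  push_cast at h2
  omega
end

section
/- Let α = [[1,1],[0,1]] ∈ SL₂(𝔽₂₅₁) (an element of order 251). There exists β ∈ SL₂(𝔽₂₅₁) such that: the order of β is 250; the order of αβ is 50; and α and β together generate SL₂(𝔽₂₅₁) (i.e., the subgroup generated by {α, β} is all of SL₂(𝔽₂₅₁)). -/
/-- The matrix `α = [[1,1],[0,1]]` in `SL₂(𝔽₂₅₁)`. -/
def alphaSL : Matrix.SpecialLinearGroup (Fin 2) (ZMod 251) :=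
  ⟨!![1, 1; 0, 1], by simp [Matrix.det_fin_two_of]⟩

open Matrix.SpecialLinearGroup (transvection transvection_coe transvection_add)

/-- Over a field, `SL₂` is generated by the upper unipotent matrices together with the
Weyl element `[[0,-1],[1,0]]`. -/
theorem eq_top_of_upper_transvection_mem_of_weyl_mem {F : Type*} [Field F]
    {H : Subgroup (Matrix.SpecialLinearGroup (Fin 2) F)}
    (hU : ∀ x : F, transvection (zero_ne_one : (0 : Fin 2) ≠ 1) x ∈ H)
    {w : Matrix.SpecialLinearGroup (Fin 2) F}
    (hw : (w : Matrix (Fin 2) (Fin 2) F) = !![0, -1; 1, 0])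
    (hwH : w ∈ H) : H = ⊤ := by
  refine (Subgroup.eq_top_iff' H).2 fun g => ?_
  induction g using Matrix.SL2.transvection_induction with
  | htransvec i j h b =>
    fin_cases i <;> fin_cases j
    · exact absurd rfl h
    · exact hU b
    · have hconj : transvection (one_ne_zero : (1 : Fin 2) ≠ 0) b * w =
          w * transvection zero_ne_one (-b) := by
        ext i j
        rw [Matrix.SpecialLinearGroup.coe_mul, Matrix.SpecialLinearGroup.coe_mul, hw]
        fin_cases i <;> fin_cases j <;> simp [transvection_coe, Matrix.mul_apply]
      exact (H.mul_mem_cancel_right hwH).1 (hconj ▸ H.mul_mem hwH (hU (-b)))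
    · exact absurd rfl h
  | hmul A B hA hB => exact H.mul_mem hA hB

theorem alphaSL_eq_transvection : alphaSL = transvection (zero_ne_one : (0 : Fin 2) ≠ 1) 1 :=
  Subtype.ext (by decide)

theorem alphaSL_pow (n : ℕ) :
    alphaSL ^ n = transvection (zero_ne_one : (0 : Fin 2) ≠ 1) (n : ZMod 251) := by
  induction n with
  | zero => simp
  | succ n ih => rw [pow_succ, ih, alphaSL_eq_transvection, Nat.cast_succ, transvection_add]

theorem upper_transvection_mem_of_alphaSL_mem
    {H : Subgroup (Matrix.SpecialLinearGroup (Fin 2) (ZMod 251))} (h : alphaSL ∈ H)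
    (x : ZMod 251) : transvection (zero_ne_one : (0 : Fin 2) ≠ 1) x ∈ H := by
  simpa only [alphaSL_pow, ZMod.natCast_zmod_val] using H.pow_mem h x.val

/-- The companion matrix of `X² - 44 X + 1`, which has order `250`. -/
def betaSL : Matrix.SpecialLinearGroup (Fin 2) (ZMod 251) :=
  ⟨!![0, -1; 1, 44], by simp⟩

theorem betaSL_pow_five : betaSL ^ 5 = ⟨!![244, 121; 130, 191], by decide⟩ :=
  Subtype.ext (by decide)

theorem betaSL_pow_twenty_five : betaSL ^ 25 = ⟨!![205, 212; 39, 164], by decide⟩ := by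
  rw [show 25 = 5 * 5 from rfl, pow_mul, betaSL_pow_five]
  exact Subtype.ext (by decide)

theorem betaSL_pow_fifty : betaSL ^ 50 = ⟨!![93, 167; 84, 24], by decide⟩ := by
  rw [show 50 = 25 * 2 from rfl, pow_mul, betaSL_pow_twenty_five]
  exact Subtype.ext (by decide)

theorem betaSL_pow_one_hundred_twenty_five : betaSL ^ 125 = -1 := by
  rw [show 125 = 25 * 5 from rfl, pow_mul, betaSL_pow_twenty_five]
  exact Subtype.ext (by decide)

theorem orderOf_betaSL : orderOf betaSL = 250 := by
  refine orderOf_eq_of_pow_and_pow_div_prime (by norm_num) ?_ fun p hp hpd => ?_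
  · rw [show 250 = 125 * 2 from rfl, pow_mul, betaSL_pow_one_hundred_twenty_five, neg_one_sq]
  · rw [show 250 = 2 * 5 ^ 3 from rfl, hp.dvd_mul] at hpd
    rcases hpd with h | h
    · obtain rfl := (Nat.prime_dvd_prime_iff_eq hp Nat.prime_two).1 h
      rw [show 250 / 2 = 125 from rfl, betaSL_pow_one_hundred_twenty_five]
      exact fun h => absurd (congrArg Subtype.val h) (by decide)
    · obtain rfl := (Nat.prime_dvd_prime_iff_eq hp Nat.prime_five).1 (hp.dvd_of_dvd_pow h)
      rw [show 250 / 5 = 50 from rfl, betaSL_pow_fifty]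
      exact fun h => absurd (congrArg Subtype.val h) (by decide)

theorem alphaSL_mul_betaSL_pow_five :
    (alphaSL * betaSL) ^ 5 = ⟨!![66, 237; 239, 52], by decide⟩ :=
  Subtype.ext (by decide)

theorem alphaSL_mul_betaSL_pow_ten :
    (alphaSL * betaSL) ^ 10 = ⟨!![6, 105; 90, 111], by decide⟩ := by
  rw [show 10 = 5 * 2 from rfl, pow_mul, alphaSL_mul_betaSL_pow_five]
  exact Subtype.ext (by decide)

theorem alphaSL_mul_betaSL_pow_twenty_five : (alphaSL * betaSL) ^ 25 = -1 := by
  rw [show 25 = 5 * 5 from rfl, pow_mul, alphaSL_mul_betaSL_pow_five]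
  exact Subtype.ext (by decide)

theorem orderOf_alphaSL_mul_betaSL : orderOf (alphaSL * betaSL) = 50 := by
  refine orderOf_eq_of_pow_and_pow_div_prime (by norm_num) ?_ fun p hp hpd => ?_
  · rw [show 50 = 25 * 2 from rfl, pow_mul, alphaSL_mul_betaSL_pow_twenty_five, neg_one_sq]
  · rw [show 50 = 2 * 5 ^ 2 from rfl, hp.dvd_mul] at hpd
    rcases hpd with h | h
    · obtain rfl := (Nat.prime_dvd_prime_iff_eq hp Nat.prime_two).1 h
      rw [show 50 / 2 = 25 from rfl, alphaSL_mul_betaSL_pow_twenty_five]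
      exact fun h => absurd (congrArg Subtype.val h) (by decide)
    · obtain rfl := (Nat.prime_dvd_prime_iff_eq hp Nat.prime_five).1 (hp.dvd_of_dvd_pow h)
      rw [show 50 / 5 = 10 from rfl, alphaSL_mul_betaSL_pow_ten]
      exact fun h => absurd (congrArg Subtype.val h) (by decide)

theorem closure_alphaSL_betaSL : Subgroup.closure {alphaSL, betaSL} = ⊤ := by
  have hw : ((betaSL * transvection zero_ne_one (-44) :
      Matrix.SpecialLinearGroup (Fin 2) (ZMod 251)) : Matrix (Fin 2) (Fin 2) (ZMod 251)) =
      !![0, -1; 1, 0] := by decide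
  have : Fact (Nat.Prime 251) := ⟨by norm_num⟩
  have hU := upper_transvection_mem_of_alphaSL_mem
    (Subgroup.subset_closure (by simp) : alphaSL ∈ Subgroup.closure {alphaSL, betaSL})
  have hβ : betaSL ∈ Subgroup.closure {alphaSL, betaSL} := Subgroup.subset_closure (by simp)
  exact eq_top_of_upper_transvection_mem_of_weyl_mem hU hw (Subgroup.mul_mem _ hβ (hU _))

/-- There exists `β ∈ SL₂(𝔽₂₅₁)` of order `250` such that `αβ` has order `50` and `α`, `β`
together generate `SL₂(𝔽₂₅₁)`, where `α = [[1,1],[0,1]]`. -/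
theorem stmt_13 :
    ∃ β : Matrix.SpecialLinearGroup (Fin 2) (ZMod 251),
      orderOf β = 250 ∧ orderOf (alphaSL * β) = 50 ∧
      Subgroup.closure {alphaSL, β} = ⊤ :=
  ⟨betaSL, orderOf_betaSL, orderOf_alphaSL_mul_betaSL, closure_alphaSL_betaSL⟩
end

section
/- Let p be a prime with p ≡ 1 (mod 3) and let n ≥ 1 be an integer. Then there are infinitely many prime numbers q such that p^n divides q² + q + 1. -/
/-- If `p ≡ 1 (mod 3)` is prime, then `X² + X + 1` has a unit root modulo every power of `p`. -/
theorem exists_unit_sq_add_self_add_one_eq_zero {p : ℕ} (hp : p.Prime) (hp3 : p % 3 = 1) (k : ℕ) :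
    ∃ u : (ZMod (p ^ (k + 1)))ˣ, (u : ZMod (p ^ (k + 1))) ^ 2 + u + 1 = 0 := by
  have : NeZero (p ^ (k + 1)) := ⟨pow_ne_zero _ hp.ne_zero⟩
  have : Fact (Nat.Prime 3) := ⟨Nat.prime_three⟩
  have hcard : 3 ∣ Nat.card (ZMod (p ^ (k + 1)))ˣ := by
    rw [Nat.card_eq_fintype_card, ZMod.card_units_eq_totient,
      Nat.totient_prime_pow_succ hp]
    exact Dvd.dvd.mul_left (by omega) _
  obtain ⟨u, hu⟩ := exists_prime_orderOf_dvd_card' 3 hcard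
  refine ⟨u, ?_⟩
  obtain ⟨b, hb⟩ := ZMod.intCast_surjective (u : ZMod (p ^ (k + 1)))
  have hcube : ((p ^ (k + 1) : ℕ) : ℤ) ∣ (b - 1) * (b ^ 2 + b + 1) := by
    rw [← ZMod.intCast_zmod_eq_zero_iff_dvd]
    have h : (u : ZMod (p ^ (k + 1))) ^ 3 = 1 := by
      rw [← Units.val_pow_eq_pow_val, ← hu, pow_orderOf_eq_one, Units.val_one]
    push_cast
    rw [hb]
    linear_combination h
  have hndvd : ¬ (p : ℤ) ∣ b - 1 := by
    intro h
    have hpow : u ^ p ^ k = 1 := by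
      have hd := dvd_sub_pow_of_dvd_sub h k
      rw [← Nat.cast_pow, ← ZMod.intCast_zmod_eq_zero_iff_dvd] at hd
      push_cast at hd
      rw [hb, one_pow, sub_eq_zero] at hd
      exact Units.ext (by simpa using hd)
    have h3 : 3 ∣ p ^ k := hu ▸ orderOf_dvd_of_pow_eq_one hpow
    have := Nat.prime_three.dvd_of_dvd_pow h3
    omega
  have hcop : IsCoprime ((p ^ (k + 1) : ℕ) : ℤ) (b - 1) := by
    push_cast
    exact ((Nat.prime_iff_prime_int.mp hp).coprime_iff_not_dvd.mpr hndvd).pow_left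
  have hroot := hcop.dvd_of_dvd_mul_left hcube
  rw [← ZMod.intCast_zmod_eq_zero_iff_dvd] at hroot
  push_cast at hroot
  rwa [hb] at hroot

/-- Let `p` be a prime with `p ≡ 1 (mod 3)` and `n ≥ 1`.  Then there are infinitely many
primes `q` such that `p ^ n` divides `q² + q + 1`. -/
theorem stmt_17 {p n : ℕ} (hp : p.Prime) (hp3 : p % 3 = 1) (hn : 1 ≤ n) :
    {q : ℕ | q.Prime ∧ p ^ n ∣ q ^ 2 + q + 1}.Infinite := by
  obtain ⟨k, rfl⟩ := Nat.exists_eq_add_of_le' hn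
  have : NeZero (p ^ (k + 1)) := ⟨pow_ne_zero _ hp.ne_zero⟩
  obtain ⟨u, hu⟩ := exists_unit_sq_add_self_add_one_eq_zero hp hp3 k
  refine (Nat.infinite_setOfPred_prime_and_eq_mod u.isUnit).mono ?_
  rintro q ⟨hq, hqu⟩
  refine ⟨hq, ?_⟩
  rw [← ZMod.natCast_eq_zero_iff]
  push_cast
  rw [hqu, hu]
end
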